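/- arXiv:2509.01520 — 2 statements merged into one kernel-verified Lean document; each statement's English description precedes it below -/
import Mathlib

section
/- Let m ≥ 1, n = 16 + m, and for i = 1, 2 let Gᵢ be the tree on n vertices obtained from 𝖳 by attaching the path 17–18–⋯–n at vertex 4 (for i = 1) or at vertex 7 (for i = 2). Then for each i the ideal of ℚ(μ)[t] generated by all (n−1)×(n−1) minors of the matrix tI − L_μ(Gᵢ) is the unit ideal; consequently the Smith normal form of tI − L_μ(Gᵢ) over ℚ(μ)[t] is diag(1, …, 1, det(tI − L_μ(Gᵢ))). -/
open scoped Classical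

/-- The edges of the tree `𝖳` on vertices `1, …, 16`: the path `1–2–⋯–9`, the pendant
edges `9–10` and `9–16`, the pendant path `3–11–12`, and the pendant path `6–13–14–15`. -/
def baseEdges : List (ℕ × ℕ) :=
  [(1,2),(2,3),(3,4),(4,5),(5,6),(6,7),(7,8),(8,9),(9,10),(9,16),
   (3,11),(11,12),(6,13),(13,14),(14,15)]

/-- The tree on `m + 16` vertices obtained from `𝖳` by attaching the path
`17–18–⋯–(16+m)` at the vertex `w` of `𝖳`.  Vertex `ℓ ∈ {1, …, 16+m}` is represented
by the element of `Fin (m+16)` with value `ℓ - 1`. -/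
def treeGraph (w m : ℕ) : SimpleGraph (Fin (m + 16)) :=
  SimpleGraph.fromRel (fun i j =>
    (i.val + 1, j.val + 1) ∈ baseEdges ∨
    (i.val + 1 = w ∧ j.val + 1 = 17) ∨
    (17 ≤ i.val + 1 ∧ j.val + 1 = i.val + 2))

/-- The matrix `t I - L_μ(G) = t I - (A(G) - μ D(G))` regarded as a matrix over the
polynomial ring `ℚ(μ)[t]`, realized as `Polynomial (RatFunc ℚ)` with `t = X` and
`μ = C RatFunc.X`. -/
noncomputable def charLmu {n : ℕ} (G : SimpleGraph (Fin n)) :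
    Matrix (Fin n) (Fin n) (Polynomial (RatFunc ℚ)) :=
  (Polynomial.X : Polynomial (RatFunc ℚ)) • (1 : Matrix (Fin n) (Fin n) (Polynomial (RatFunc ℚ))) -
    (G.adjMatrix (Polynomial (RatFunc ℚ)) -
      Polynomial.C (RatFunc.X : RatFunc ℚ) •
        Matrix.diagonal (fun v => (G.degree v : Polynomial (RatFunc ℚ))))

namespace Matrix

variable {ι R : Type*} [Fintype ι] [DecidableEq ι] [CommRing R]

/-- Two square matrices are unimodularly equivalent if they agree up to multiplication by
matrices of unit determinant on both sides. -/
def UnimodularEquiv (M N : Matrix ι ι R) : Prop :=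
  ∃ U W : Matrix ι ι R, IsUnit U.det ∧ IsUnit W.det ∧ U * M * W = N

theorem UnimodularEquiv.refl (M : Matrix ι ι R) : UnimodularEquiv M M :=
  ⟨1, 1, by simp, by simp, by simp⟩

theorem UnimodularEquiv.trans {M N P : Matrix ι ι R} (h : UnimodularEquiv M N)
    (h' : UnimodularEquiv N P) : UnimodularEquiv M P := by
  obtain ⟨U, W, hU, hW, rfl⟩ := h
  obtain ⟨U', W', hU', hW', rfl⟩ := h'
  exact ⟨U' * U, W * W', by simpa using ⟨hU', hU⟩, by simpa using ⟨hW, hW'⟩,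
    by simp only [Matrix.mul_assoc]⟩

theorem transvection_mul_apply {i j : ι} (c : R) (M : Matrix ι ι R) (r k : ι) :
    (transvection i j c * M) r k = M r k + if r = i then c * M j k else 0 := by
  split_ifs with h
  · subst h; simp
  · simp [h]

theorem mul_transvection_apply {i j : ι} (c : R) (M : Matrix ι ι R) (r k : ι) :
    (M * transvection i j c) r k = M r k + if k = j then c * M r i else 0 := by
  split_ifs with h
  · subst h; simp
  · simp [h]

/-- Two coprime diagonal entries can be replaced by `1` and their product. -/
theorem unimodularEquiv_diagonal_update {a : ι → R} {i j : ι} (hij : i ≠ j)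
    (h : IsCoprime (a i) (a j)) :
    UnimodularEquiv (diagonal a)
      (diagonal (Function.update (Function.update a i 1) j (a i * a j))) := by
  obtain ⟨u, v, huv⟩ := h
  refine ⟨transvection j i (a i * a j - a j) * transvection i j v,
    transvection i j u * (transvection j i (1 - a i) * transvection i j (-1)), ?_, ?_, ?_⟩
  · simp [det_transvection_of_ne, hij, hij.symm]
  · simp [det_transvection_of_ne, hij, hij.symm]
  · ext r k
    simp only [← Matrix.mul_assoc, mul_transvection_apply]
    simp only [Matrix.mul_assoc, transvection_mul_apply]
    have hji := hij.symm
    by_cases hri : r = i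
    · subst hri
      by_cases hki : k = r
      · subst hki
        simp [hij, hji]
        linear_combination (1 - a k) * huv
      · by_cases hkj : k = j
        · subst hkj
          simp [hij, hji]
          linear_combination a r * huv
        · simp [hij, hki, hkj, Ne.symm hki, Ne.symm hkj]
    · by_cases hrj : r = j
      · subst hrj
        by_cases hki : k = i
        · subst hki
          simp [hij, hji]
          linear_combination (a r * (a k - 1) * (1 - a k)) * huv
        · by_cases hkj : k = r
          · subst hkj
            simp [hij, hji]
            linear_combination (a k * (a i - 1) * (a i)) * huv
          · simp [hji, hki, hkj, Ne.symm hki, Ne.symm hkj]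
      · by_cases hki : k = i
        · subst hki
          simp [hij, hri, hrj]
        · by_cases hkj : k = j
          · subst hkj
            simp [hij, hji, hri, hrj]
          · simp [hki, hkj, hri, hrj, diagonal_apply]

/-- A diagonal matrix with pairwise coprime entries is equivalent to one having a single
diagonal entry different from `1`. -/
theorem unimodularEquiv_diagonal_prod {a : ι → R} (h : Pairwise (IsCoprime.onFun a)) (j : ι) :
    UnimodularEquiv (diagonal a) (diagonal fun k => if k = j then ∏ i, a i else 1) := by
  have key : ∀ s : Finset ι, j ∉ s → UnimodularEquiv (diagonal a)
      (diagonal fun k => if k ∈ s then 1 else if k = j then a j * ∏ i ∈ s, a i else a k) := by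
    intro s
    induction s using Finset.induction_on with
    | empty =>
      intro _
      convert UnimodularEquiv.refl (diagonal a) using 2
      ext k
      by_cases hk : k = j <;> simp [hk]
    | insert i s his ih =>
      intro hj
      obtain ⟨hji, hjs⟩ : j ≠ i ∧ j ∉ s := by simpa using hj
      refine (ih hjs).trans ?_
      have hc : IsCoprime (a i) (a j * ∏ i ∈ s, a i) :=
        (h hji.symm).mul_right (IsCoprime.prod_right fun k hk => h (by rintro rfl; exact his hk))
      convert unimodularEquiv_diagonal_update (a := fun k => if k ∈ s then 1 else
        if k = j then a j * ∏ i ∈ s, a i else a k) hji.symm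
        (by simpa [his, hjs, hji.symm] using hc) using 2
      ext k
      by_cases hkj : k = j
      · subst hkj
        simp [hjs, hji, hji.symm, his, Finset.prod_insert his]
        ring
      · by_cases hki : k = i
        · subst hki; simp [hkj]
        · simp [hkj, hki]
  convert key (Finset.univ.erase j) (by simp) using 2
  ext k
  by_cases hk : k = j <;> simp [hk, Finset.mul_prod_erase]

/-- Over a principal ideal domain, a square matrix of nonzero determinant is equivalent to a
diagonal matrix. -/
theorem exists_unimodularEquiv_diagonal [IsDomain R] [IsPrincipalIdealRing R]
    (M : Matrix ι ι R) (hM : M.det ≠ 0) : ∃ a : ι → R, UnimodularEquiv M (diagonal a) := by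
  have hinj : Function.Injective (Matrix.toLin' M) := by
    rw [← LinearMap.ker_eq_bot, Matrix.ker_toLin'_eq_bot_iff]
    intro v hv
    by_contra hne
    exact hM (Matrix.exists_mulVec_eq_zero_iff.mp ⟨v, hne, hv⟩)
  obtain ⟨b, a, c, hc⟩ := Submodule.exists_smith_normal_form_of_rank_eq (Pi.basisFun R ι)
    (N := LinearMap.range (Matrix.toLin' M)) (LinearMap.finrank_range_of_inj hinj)
  let e := LinearEquiv.ofInjective _ hinj
  let c' := c.map e.symm
  have hc' : ∀ i, M *ᵥ c' i = a i • b i := by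
    intro i
    rw [← hc, ← Matrix.toLin'_apply, ← LinearEquiv.ofInjective_apply _ (h := hinj)]
    simp [c', e]
  refine ⟨a, b.toMatrix (Pi.basisFun R ι), (Pi.basisFun R ι).toMatrix c', ?_, ?_, ?_⟩
  · exact IsUnit.of_mul_eq_one ((Pi.basisFun R ι).toMatrix b).det
      (by rw [← det_mul, Module.Basis.toMatrix_mul_toMatrix_flip, det_one])
  · exact IsUnit.of_mul_eq_one (c'.toMatrix (Pi.basisFun R ι)).det
      (by rw [← det_mul, Module.Basis.toMatrix_mul_toMatrix_flip, det_one])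
  · have h1 : M * (Pi.basisFun R ι).toMatrix c' = (Pi.basisFun R ι).toMatrix b * diagonal a := by
      ext r k
      have := congrFun (hc' k) r
      rw [mul_diagonal, mul_comm]
      simpa [Module.Basis.toMatrix_apply, Matrix.mul_apply, mulVec, dotProduct] using this
    rw [Matrix.mul_assoc, h1, ← Matrix.mul_assoc, Module.Basis.toMatrix_mul_toMatrix_flip,
      Matrix.one_mul]

/-- Over a principal ideal domain, if the kernel of a square matrix of nonzero determinant has
dimension at most one over every residue field, witnessed by a coordinate which is injective on
that kernel, then all but the last of its invariant factors are trivial. -/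
theorem unimodularEquiv_diagonal_det {R : Type*} [CommRing R] [IsDomain R]
    [IsPrincipalIdealRing R] (M : Matrix ι ι R) (hM : M.det ≠ 0)
    (hker : ∀ (P : Ideal R) [P.IsMaximal], ∃ k, ∀ x : ι → R ⧸ P,
      M.map (Ideal.Quotient.mk P) *ᵥ x = 0 → x k = 0 → x = 0) (j : ι) :
    UnimodularEquiv M (diagonal fun k => if k = j then M.det else 1) := by
  obtain ⟨a, U, W, hU, hW, hUW⟩ := exists_unimodularEquiv_diagonal M hM
  have hcop : Pairwise (IsCoprime.onFun a) := by
    intro i l hil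
    by_contra hnot
    have hne : Ideal.span {a i, a l} ≠ ⊤ := fun h => hnot <| by
      have h1 : (1 : R) ∈ Ideal.span {a i, a l} := by simp [h]
      obtain ⟨u, v, huv⟩ := Ideal.mem_span_pair.mp h1
      exact ⟨u, v, huv⟩
    obtain ⟨P, hP, hle⟩ := Ideal.exists_le_maximal _ hne
    let := Ideal.Quotient.field P
    obtain ⟨k, hk⟩ := hker P
    let q := Ideal.Quotient.mk P
    have hai : q (a i) = 0 := Ideal.Quotient.eq_zero_iff_mem.mpr (hle (Ideal.subset_span (by simp)))
    have hal : q (a l) = 0 := Ideal.Quotient.eq_zero_iff_mem.mpr (hle (Ideal.subset_span (by simp)))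
    have hUP : IsUnit (U.map q) := by
      rw [Matrix.isUnit_iff_isUnit_det, ← RingHom.mapMatrix_apply, ← RingHom.map_det]
      exact hU.map q
    have hWP : IsUnit (W.map q) := by
      rw [Matrix.isUnit_iff_isUnit_det, ← RingHom.mapMatrix_apply, ← RingHom.map_det]
      exact hW.map q
    have hprod : U.map q * M.map q * W.map q = diagonal (q ∘ a) := by
      rw [← Matrix.map_mul, ← Matrix.map_mul, hUW, Matrix.diagonal_map (map_zero q)]
      rfl
    have hz : ∀ y : ι → R ⧸ P, diagonal (q ∘ a) *ᵥ y = 0 → M.map q *ᵥ (W.map q *ᵥ y) = 0 := by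
      intro y hy
      apply Matrix.mulVec_injective_of_isUnit hUP
      simp only [mulVec_mulVec, mulVec_zero]
      rw [← Matrix.mul_assoc, hprod, hy]
    let f : R ⧸ P → R ⧸ P → ι → R ⧸ P := fun α β => Pi.single i α + Pi.single l β
    have hf : ∀ α β, diagonal (q ∘ a) *ᵥ f α β = 0 := by
      intro α β
      ext r
      simp only [mulVec_diagonal, f, Pi.add_apply, Pi.zero_apply, Function.comp]
      by_cases hri : r = i
      · subst hri; simp [hai]
      · by_cases hrl : r = l
        · subst hrl; simp [hal]
        · simp [hri, hrl]
    have hf0 : ∀ α β, (W.map q *ᵥ f α β) k = 0 → α = 0 ∧ β = 0 := by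
      intro α β h0
      have h1 := hk _ (hz _ (hf α β)) h0
      have h2 : f α β = 0 := Matrix.mulVec_injective_of_isUnit hWP (by simpa using h1)
      have hi := congrFun h2 i
      have hl := congrFun h2 l
      simp [f, hil, hil.symm] at hi hl
      exact ⟨hi, hl⟩
    have hlin : ∀ α β, (W.map q *ᵥ f α β) k = W.map q k i * α + W.map q k l * β := by
      intro α β
      simp [f, mulVec_add, mul_comm]
    have h1 := hf0 (W.map q k l) (-W.map q k i) (by rw [hlin]; ring)
    have h2 := hf0 1 0 (by rw [hlin, neg_eq_zero.mp h1.2]; ring)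
    exact one_ne_zero h2.1
  obtain ⟨U', W', hU', hW', h'⟩ :=
    (show UnimodularEquiv M (diagonal a) from ⟨U, W, hU, hW, hUW⟩).trans
      (unimodularEquiv_diagonal_prod hcop j)
  have hdet : U'.det * M.det * W'.det = ∏ i, a i := by
    rw [← det_mul, ← det_mul, h', det_diagonal]
    simp
  obtain ⟨u, hu⟩ := hU'
  obtain ⟨w, hw⟩ := hW'
  refine ⟨diagonal (fun k => if k = j then (↑(u⁻¹ * w⁻¹) : R) else 1) * U', W', ?_, ?_, ?_⟩
  · rw [det_mul, det_diagonal, ← hu]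
    simp
  · exact hw ▸ w.isUnit
  · rw [Matrix.mul_assoc, Matrix.mul_assoc, ← Matrix.mul_assoc U', h', diagonal_mul_diagonal]
    congr 1
    ext k
    split_ifs
    · rw [← hdet, ← hu, ← hw]
      calc (↑(u⁻¹ * w⁻¹) : R) * (u * M.det * w)
          = (↑(u⁻¹ * u) : R) * ↑(w⁻¹ * w) * M.det := by push_cast; ring
        _ = M.det := by simp
    · simp

/-- If all but one invariant factors of a square matrix are trivial, then its submaximal minors
generate the unit ideal. -/
theorem span_minors_eq_top {n : ℕ} (M : Matrix (Fin (n + 1)) (Fin (n + 1)) R) (j : Fin (n + 1))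
    (d : R) (h : UnimodularEquiv M (diagonal fun k => if k = j then d else 1)) :
    Ideal.span {x | ∃ i k : Fin (n + 1), x = (M.submatrix i.succAbove k.succAbove).det} = ⊤ := by
  obtain ⟨U, W, -, -, h⟩ := h
  have h1 := congrFun (congrFun (congrArg adjugate h) j) j
  rw [adjugate_mul_distrib, adjugate_mul_distrib, adjugate_diagonal, diagonal_apply_eq,
    Finset.prod_eq_one (fun k hk => if_neg (Finset.ne_of_mem_erase hk))] at h1
  rw [Ideal.eq_top_iff_one, ← h1, mul_apply]
  refine Ideal.sum_mem _ fun r _ => Ideal.mul_mem_left _ _ ?_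
  rw [mul_apply]
  refine Ideal.sum_mem _ fun s _ => Ideal.mul_mem_right _ _ ?_
  rw [adjugate_fin_succ_eq_det_submatrix]
  exact Ideal.mul_mem_left _ _ (Ideal.subset_span ⟨_, _, rfl⟩)

end Matrix

open Polynomial in
theorem Polynomial.aeval_ne_zero_of_transcendental {K : Type*} [Field K] [Algebra ℚ K] {z : K}
    (hz : Transcendental ℚ z) {p : ℚ[X]} (r : ℚ) (hp : p.eval r ≠ 0) : aeval z p ≠ 0 := fun h =>
  hz ⟨p, by rintro rfl; simp at hp, h⟩

/-- The sequence with `L₀ = a`, `L₁ = b` and `L_{k+2} = s L_{k+1} - L_k`. -/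
def legSeq {R : Type*} [CommRing R] (s a b : R) : ℕ → R
  | 0 => a
  | 1 => b
  | k + 2 => s * legSeq s a b (k + 1) - legSeq s a b k

section legSeq

variable {R : Type*} [CommRing R]

theorem map_legSeq {S : Type*} [CommRing S] {F : Type*} [FunLike F R S] [RingHomClass F R S]
    (f : F) (s a b : R) (k : ℕ) : f (legSeq s a b k) = legSeq (f s) (f a) (f b) k := by
  induction k using legSeq.induct with
  | case1 => rfl
  | case2 => rfl
  | case3 k ih1 ih2 => simp [legSeq, ih1, ih2]

theorem legSeq_add_mul (s a b c d z : R) (k : ℕ) :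
    legSeq s (a + z * c) (b + z * d) k = legSeq s a b k + z * legSeq s c d k := by
  induction k using legSeq.induct with
  | case1 => rfl
  | case2 => rfl
  | case3 k ih1 ih2 => rw [legSeq, ih1, ih2, legSeq, legSeq]; ring

theorem mul_legSeq (s a b z : R) (k : ℕ) :
    z * legSeq s a b k = legSeq s (z * a) (z * b) k := by
  induction k using legSeq.induct with
  | case1 => rfl
  | case2 => rfl
  | case3 k ih1 ih2 => rw [legSeq, legSeq, ← ih1, ← ih2]; ring

theorem legSeq_two (a b : R) (k : ℕ) : legSeq 2 a b k = a + k * (b - a) := by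
  induction k using legSeq.induct with
  | case1 => simp [legSeq]
  | case2 => simp [legSeq]
  | case3 k ih1 ih2 => rw [legSeq, ih1, ih2]; push_cast; ring

theorem eq_zero_of_legSeq_mul_eq_zero {s a f : R} {k : ℕ} (h0 : legSeq s 1 a k * f = 0)
    (h1 : legSeq s 1 a (k + 1) * f = 0) : f = 0 := by
  induction k with
  | zero => simpa [legSeq] using h0
  | succ k ih =>
    refine ih ?_ h0
    rw [legSeq] at h1
    linear_combination s * h0 - h1

end legSeq

section Kernel

open Polynomial

variable {K : Type*} [Field K] [Algebra ℚ K] {s u : K}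

/-- The equations satisfied by a kernel vector of `t I - L_μ` on the tree `𝖳`, at all vertices
other than `4` and `7`; here `u` stands for `μ` and `s` for `t + 2 μ`, and vertices carry their
labels `1, …, 16`. -/
structure BaseEquations (s u : K) (x : ℕ → K) : Prop where
  h1 : (s - u) * x 1 = x 2
  h2 : s * x 2 = x 1 + x 3
  h3 : (s + u) * x 3 = x 2 + x 4 + x 11
  h5 : s * x 5 = x 4 + x 6
  h6 : (s + u) * x 6 = x 5 + x 7 + x 13
  h8 : s * x 8 = x 7 + x 9
  h9 : (s + u) * x 9 = x 8 + x 10 + x 16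
  h10 : (s - u) * x 10 = x 9
  h11 : s * x 11 = x 3 + x 12
  h12 : (s - u) * x 12 = x 11
  h13 : s * x 13 = x 6 + x 14
  h14 : s * x 14 = x 13 + x 15
  h15 : (s - u) * x 15 = x 14
  h16 : (s - u) * x 16 = x 9

/-- The equations at the vertices `4` and `7` when a path is attached at `w`; here `q` is the
value of the kernel vector at the vertex next to `w` on that path. -/
def AttachEquations (w : ℕ) (s u : K) (x : ℕ → K) (q : K) : Prop :=
  (w = 4 ∧ (s + u) * x 4 = x 3 + x 5 + q ∧ s * x 7 = x 6 + x 8) ∨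
  (w = 7 ∧ s * x 4 = x 3 + x 5 ∧ (s + u) * x 7 = x 6 + x 8 + q)

/-- `x` satisfies the kernel equations on the tree with a path of length `m + 1` attached at `w`,
where `f` is the value at the leaf end of that path. -/
def KernelEquations (w m : ℕ) (s u : K) (x : ℕ → K) (f : K) : Prop :=
  BaseEquations s u x ∧ x w = legSeq s 1 (s - u) (m + 1) * f ∧
    AttachEquations w s u x (legSeq s 1 (s - u) m * f)

/-- A combination of two consecutive terms of `legSeq` at a transcendental element is nonzero
provided that it is nonzero at `2`. -/
theorem legSeq_combination_ne_zero {z : K} (hz : Transcendental ℚ z) (A B a b : ℚ[X]) (m : ℕ)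
    (h : A.eval 2 * (a.eval 2 + (m + 1) * (b.eval 2 - a.eval 2)) -
      B.eval 2 * (a.eval 2 + m * (b.eval 2 - a.eval 2)) ≠ 0) :
    aeval z A * legSeq z (aeval z a) (aeval z b) (m + 1) -
      aeval z B * legSeq z (aeval z a) (aeval z b) m ≠ 0 := by
  have he : ∀ k, eval 2 (legSeq X a b k) = legSeq (2 : ℚ) (a.eval 2) (b.eval 2) k := fun k => by
    simpa using map_legSeq (evalRingHom (2 : ℚ)) X a b k
  have := aeval_ne_zero_of_transcendental hz (p := A * legSeq X a b (m + 1) - B * legSeq X a b m) 2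
    (by simpa [he, legSeq_two] using h)
  simpa [map_legSeq] using this

/-- At `t = -μ`, a kernel vector vanishing at vertex `10` vanishes at all leaves. -/
theorem leaves_eq_zero_of_eq (hu : Transcendental ℚ s) {w m : ℕ}
    {x : ℕ → K} {f : K} (h : KernelEquations w m s s x f) (hx : x 10 = 0) :
    x 1 = 0 ∧ x 10 = 0 ∧ x 12 = 0 ∧ x 15 = 0 ∧ x 16 = 0 ∧ f = 0 := by
  obtain ⟨⟨h1, h2, h3, h5, h6, h8, h9, h10, h11, h12, h13, h14, h15, h16⟩, hf, ha⟩ := h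
  have hs : s ≠ 0 := fun h => hu (h ▸ isAlgebraic_zero)
  have := algebraRat.charZero K
  have h2s : 2 * s ≠ 0 := mul_ne_zero two_ne_zero hs
  have e2 : x 2 = 0 := by linear_combination -h1
  have e11 : x 11 = 0 := by linear_combination -h12
  have e14 : x 14 = 0 := by linear_combination -h15
  have e9 : x 9 = 0 := by linear_combination -h16
  have e1 : x 1 = -x 3 := by linear_combination -h2 + s * e2
  have e12 : x 12 = -x 3 := by linear_combination -h11 + s * e11
  have e13 : x 13 = -x 15 := by linear_combination -h14 + s * e14
  have e6 : x 6 = -s * x 15 := by linear_combination -h13 + s * e13 - e14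
  have e4 : x 4 = 2 * s * x 3 := by linear_combination -h3 - e2 - e11
  have e16 : x 16 = -x 8 := by linear_combination -h9 + 2 * s * e9 - hx
  have e7 : x 7 = s * x 8 := by linear_combination -h8 - e9
  rw [sub_self] at hf ha
  rcases ha with ⟨rfl, h4, h7⟩ | ⟨rfl, h4, h7⟩
  · have e6' : x 6 = (s ^ 2 - 1) * x 8 := by linear_combination -h7 + s * e7
    have e5 : s * x 5 = (2 * s ^ 4 - 4 * s ^ 2 + 1) * x 8 := by
      linear_combination -s * h6 - s * e13 - s * e7 + (2 * s ^ 2 - 1) * e6' + e6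
    have e4' : x 4 = (2 * s ^ 4 - 5 * s ^ 2 + 2) * x 8 := by linear_combination -h5 + e5 - e6'
    have hD := legSeq_combination_ne_zero hu
      (4 * X ^ 2 * (2 * X ^ 4 - 5 * X ^ 2 + 2) - (2 * X ^ 4 - 5 * X ^ 2 + 2)
        - 2 * (2 * X ^ 4 - 4 * X ^ 2 + 1)) (2 * X * (2 * X ^ 4 - 5 * X ^ 2 + 2)) 1 0 m (by
        simp
        norm_num
        intro h
        have : (64 : ℚ) = 120 * (m + 1) := by linear_combination h
        norm_cast at this
        omega)
    simp only [map_sub, map_mul, map_add, map_pow, aeval_X, map_ofNat, map_one, map_zero] at hD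
    have e8 : x 8 = 0 := by
      refine (mul_eq_zero.mp ?_).resolve_left hD
      generalize legSeq s 1 0 (m + 1) = p at *
      generalize legSeq s 1 0 m = q at *
      linear_combination (-((4 * s ^ 2 - 1) * p - 2 * s * q)) * e4' + 2 * p * e5 - p * e4 +
        2 * p * s * h4 - 2 * s * q * hf
    have e4'' : x 4 = 0 := by rw [e4', e8, mul_zero]
    have e3 : x 3 = 0 := (mul_eq_zero.mp (e4.symm.trans e4'')).resolve_left h2s
    have e5' : x 5 = 0 := (mul_eq_zero.mp (e5.trans (by rw [e8, mul_zero]))).resolve_left hs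
    have e15 : x 15 = 0 := (mul_eq_zero.mp (e6.symm.trans (by rw [e6', e8, mul_zero]))).resolve_left
      (neg_ne_zero.mpr hs)
    refine ⟨by simp [e1, e3], hx, by simp [e12, e3], e15, by simp [e16, e8],
      eq_zero_of_legSeq_mul_eq_zero (s := s) (a := 0) (k := m) ?_ ?_⟩
    · linear_combination -h4 + 2 * s * e4'' - e3 - e5'
    · rw [← hf, e4'']
  · have e5 : x 5 = (2 * s ^ 2 - 1) * x 3 := by linear_combination -h4 + s * e4
    have e6' : x 6 = (2 * s ^ 3 - 3 * s) * x 3 := by linear_combination -h5 + s * e5 - e4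
    have e15 : x 15 = -(2 * s ^ 2 - 3) * x 3 := by
      refine mul_left_cancel₀ hs ?_
      linear_combination e6 - e6'
    have e7' : x 7 = 2 * (2 * s ^ 4 - 5 * s ^ 2 + 2) * x 3 := by
      linear_combination -h6 + 2 * s * e6' - e5 - e13 + e15
    have hD := legSeq_combination_ne_zero hu
      (2 * (2 * X ^ 2 - 1) * (2 * X ^ 4 - 5 * X ^ 2 + 2) - (2 * X ^ 4 - 3 * X ^ 2))
      (2 * X * (2 * X ^ 4 - 5 * X ^ 2 + 2)) 1 0 m (by
        simp
        norm_num
        intro h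
        have : (64 : ℚ) = 120 * (m + 1) := by linear_combination h
        norm_cast at this
        omega)
    simp only [map_sub, map_mul, map_add, map_pow, aeval_X, map_ofNat, map_one, map_zero] at hD
    have e3 : x 3 = 0 := by
      refine (mul_eq_zero.mp ?_).resolve_left hD
      generalize legSeq s 1 0 (m + 1) = p at *
      generalize legSeq s 1 0 m = q at *
      linear_combination (-((2 * s ^ 2 - 1) * p - s * q)) * e7' + p * s * e6' + p * s * h7
        - p * e7 - s * q * hf
    have e7'' : x 7 = 0 := by rw [e7', e3, mul_zero]
    have e8 : x 8 = 0 := (mul_eq_zero.mp (e7.symm.trans e7'')).resolve_left hs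
    refine ⟨by simp [e1, e3], hx, by simp [e12, e3], by simp [e15, e3], by simp [e16, e8],
      eq_zero_of_legSeq_mul_eq_zero (s := s) (a := 0) (k := m) ?_ ?_⟩
    · linear_combination -h7 + 2 * s * e7'' - e6' - (2 * s ^ 3 - 3 * s) * e3 - e8
    · rw [← hf, e7'']

/-- At `(t + 2μ)(t + μ) = 1`, a kernel vector vanishing at vertex `1` vanishes at all leaves. -/
theorem leaves_eq_zero_of_mul_eq_one (hu : Transcendental ℚ u) (hsu : s * (s - u) = 1) {w m : ℕ}
    {x : ℕ → K} {f : K} (h : KernelEquations w m s u x f) (hx : x 1 = 0) :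
    x 1 = 0 ∧ x 10 = 0 ∧ x 12 = 0 ∧ x 15 = 0 ∧ x 16 = 0 ∧ f = 0 := by
  obtain ⟨⟨h1, h2, h3, h5, h6, h8, h9, h10, h11, h12, h13, h14, h15, h16⟩, hf, ha⟩ := h
  have hs : s ≠ 0 := left_ne_zero_of_mul_eq_one hsu
  have := algebraRat.charZero K
  have hst : Transcendental ℚ s := fun hs' => hu <| by
    have : u = s - s⁻¹ := by field_simp; linear_combination -hsu
    rw [this]
    exact hs'.sub hs'.inv
  have hleg : ∀ k, s * legSeq s 1 (s - u) k = legSeq s s 1 k := fun k => by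
    rw [mul_legSeq, hsu, mul_one]
  have e2 : x 2 = 0 := by rw [← h1, hx, mul_zero]
  have e3 : x 3 = 0 := by linear_combination -h2 + s * e2 - hx
  have e12 : x 12 = s * x 11 := by linear_combination s * h12 - x 12 * hsu
  have e4 : x 4 = -x 11 := by linear_combination -h3 + (s + u) * e3 - e2
  have e10 : x 10 = s * x 9 := by linear_combination s * h10 - x 10 * hsu
  have e16 : x 16 = s * x 9 := by linear_combination s * h16 - x 16 * hsu
  have e15 : x 15 = s * x 14 := by linear_combination s * h15 - x 15 * hsu
  have e13 : x 13 = 0 := by linear_combination -h14 - e15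
  have e6 : x 6 = -x 14 := by linear_combination -h13 + s * e13
  have e8 : s * x 8 = -x 9 := by linear_combination -s * h9 - s * e10 - s * e16 - x 9 * hsu
  have e7 : x 7 = -2 * x 9 := by linear_combination -h8 + e8
  rcases ha with ⟨rfl, h4, h7⟩ | ⟨rfl, h4, h7⟩
  · have e6' : s * x 6 = (1 - 2 * s ^ 2) * x 9 := by linear_combination -s * h7 + s ^ 2 * e7 - e8
    have e5 : s ^ 2 * x 5 = (-4 * s ^ 4 + 6 * s ^ 2 - 1) * x 9 := by
      linear_combination -s ^ 2 * h6 - s ^ 2 * e7 - s ^ 2 * e13 + (2 * s ^ 2 - 1) * e6'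
        - s * x 6 * hsu
    have e4' : s * x 4 = (-4 * s ^ 4 + 8 * s ^ 2 - 2) * x 9 := by
      linear_combination -s * h5 + e5 - e6'
    have h4' : (2 * s ^ 2 - 1) * x 4 = s * x 5 + s * (legSeq s 1 (s - u) m * f) := by
      linear_combination s * h4 + s * e3 + x 4 * hsu
    have hD := legSeq_combination_ne_zero hst
      ((2 * X ^ 2 - 1) * (-4 * X ^ 4 + 8 * X ^ 2 - 2) - (-4 * X ^ 4 + 6 * X ^ 2 - 1))
      (X * (-4 * X ^ 4 + 8 * X ^ 2 - 2)) X 1 m (by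
        simp
        norm_num
        intro h
        have : (129 : ℚ) * (m + 1) = 190 := by linear_combination h
        norm_cast at this
        omega)
    simp only [map_sub, map_mul, map_add, map_neg, map_pow, aeval_X, map_ofNat, map_one] at hD
    rw [← hleg, ← hleg] at hD
    have e9 : x 9 = 0 := by
      refine (mul_eq_zero.mp ?_).resolve_left hD
      generalize legSeq s 1 (s - u) (m + 1) = p at *
      generalize legSeq s 1 (s - u) m = q at *
      linear_combination s * ((-((2 * s ^ 2 - 1) * p - s * q)) * e4' + p * e5 + p * s * h4' -
        s ^ 2 * q * hf)
    simp only [e9, mul_zero, mul_eq_zero, hs, false_or, pow_eq_zero_iff, ne_eq,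
      OfNat.ofNat_ne_zero, not_false_eq_true] at e4' e5 e6' e10 e16
    have e14 : x 14 = 0 := by linear_combination e6 - e6'
    refine ⟨hx, e10, by linear_combination e12 + s * e4 - s * e4', by rw [e15, e14, mul_zero], e16,
      eq_zero_of_legSeq_mul_eq_zero (s := s) (a := s - u) (k := m) ?_ ?_⟩
    · linear_combination -h4 + (s + u) * e4' - e3 - e5
    · rw [← hf, e4']
  · have e5 : x 5 = s * x 4 := by linear_combination -h4 - e3
    have e6' : x 6 = (s ^ 2 - 1) * x 4 := by linear_combination -h5 + s * e5
    have e7' : s * x 7 = (2 * s ^ 4 - 4 * s ^ 2 + 1) * x 4 := by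
      linear_combination -s * h6 - s * e5 - s * e13 + (2 * s ^ 2 - 1) * e6' - x 6 * hsu
    have h7' : (4 * s ^ 2 - 3) * x 7 = 2 * s * x 6 + 2 * s * (legSeq s 1 (s - u) m * f) := by
      linear_combination 2 * s * h7 + 2 * x 7 * hsu + 2 * e8 - e7
    have hD := legSeq_combination_ne_zero hst
      ((4 * X ^ 2 - 3) * (2 * X ^ 4 - 4 * X ^ 2 + 1) - 2 * X ^ 2 * (X ^ 2 - 1))
      (2 * X * (2 * X ^ 4 - 4 * X ^ 2 + 1)) X 1 m (by
        simp
        norm_num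
        intro h
        have : (129 : ℚ) * (m + 1) = 190 := by linear_combination -h
        norm_cast at this
        omega)
    simp only [map_sub, map_mul, map_add, map_pow, aeval_X, map_ofNat, map_one] at hD
    rw [← hleg, ← hleg] at hD
    have e4' : x 4 = 0 := by
      refine (mul_eq_zero.mp ?_).resolve_left hD
      generalize legSeq s 1 (s - u) (m + 1) = p at *
      generalize legSeq s 1 (s - u) m = q at *
      linear_combination s * ((-((4 * s ^ 2 - 3) * p - 2 * s * q)) * e7' + 2 * s ^ 2 * p * e6' +
        p * s * h7' - 2 * s ^ 2 * q * hf)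
    simp only [e4', mul_zero, mul_eq_zero, hs, false_or] at e5 e6' e7'
    have e9 : x 9 = 0 := by
      refine (mul_eq_zero.mp (e7.symm.trans e7')).resolve_left (by norm_num)
    simp only [e9, mul_zero, neg_zero, mul_eq_zero, hs, false_or] at e8 e10 e16
    have e14 : x 14 = 0 := by linear_combination e6 - e6'
    refine ⟨hx, e10, by linear_combination e12 + s * e4 - s * e4', by rw [e15, e14, mul_zero], e16,
      eq_zero_of_legSeq_mul_eq_zero (s := s) (a := s - u) (k := m) ?_ ?_⟩
    · linear_combination -h7 + (s + u) * e7' - e6' - e8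
    · rw [← hf, e7']

/-- The path polynomials do not vanish on the curve `s³ - s μ² - 3 s + μ = 0`. -/
theorem legSeq_ne_zero_of_cubic (hu : Transcendental ℚ u)
    (hQ : s ^ 3 - s * u ^ 2 - 3 * s + u = 0) (m : ℕ) : legSeq s 1 (s - u) (m + 1) ≠ 0 := by
  intro h
  have := algebraRat.charZero K
  have hst : Transcendental ℚ s := by
    intro hs
    refine hu ?_
    by_cases hs0 : s = 0
    · have : u = 0 := by subst hs0; linear_combination hQ
      exact this ▸ isAlgebraic_zero
    have h2 : IsAlgebraic ℚ (2 : K) := by exact_mod_cast isAlgebraic_natCast 2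
    have h3 : IsAlgebraic ℚ ((2 * s * u - 1) ^ 2) := by
      have : (2 * s * u - 1) ^ 2 = 2 * (2 * s ^ 4 - 2 * (2 * s ^ 2 + s ^ 2)) + 1 := by
        linear_combination -4 * s * hQ
      rw [this]
      have h2s := h2.mul (hs.pow 2)
      exact (h2.mul ((h2.mul (hs.pow 4)).sub (h2.mul (h2s.add (hs.pow 2))))).add isAlgebraic_one
    have h4 : IsAlgebraic ℚ (2 * s * u - 1) := h3.of_pow two_pos
    have : u = ((2 * s * u - 1) + 1) * (2 * s)⁻¹ := by field_simp; ring
    rw [this]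
    exact (h4.add isAlgebraic_one).mul (h2.mul hs).inv
  have hUV : legSeq s 1 s (m + 1) = u * legSeq s 0 1 (m + 1) := by
    have := legSeq_add_mul s 1 s 0 1 (-u) (m + 1)
    simp only [mul_zero, add_zero, mul_one, ← sub_eq_add_neg, h] at this
    linear_combination -this
  have he : ∀ (a b : ℚ[X]) k, eval 2 (legSeq X a b k) = legSeq (2 : ℚ) (a.eval 2) (b.eval 2) k :=
    fun a b k => by simpa using map_legSeq (evalRingHom (2 : ℚ)) X a b k
  have hne := aeval_ne_zero_of_transcendental hst (p := X * legSeq X 1 X (m + 1) ^ 2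
    - legSeq X 1 X (m + 1) * legSeq X 0 1 (m + 1)
    - (X ^ 3 - 3 * X) * legSeq X 0 1 (m + 1) ^ 2) 2 (by
      simp [he, legSeq_two]
      intro h
      have h' : (m : ℚ) * m = m + 4 := by linear_combination -h
      norm_cast at h'
      rcases Nat.lt_or_ge m 3 with hm | hm
      · interval_cases m <;> omega
      · nlinarith)
  apply hne
  simp only [map_sub, map_mul, map_pow, aeval_X, map_ofNat, map_legSeq, map_one, map_zero]
  rw [hUV]
  linear_combination -legSeq s 0 1 (m + 1) ^ 2 * hQ

/-- Away from the two special loci, some leaf among `1`, `10`, `15` detects kernel vectors. -/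
theorem exists_leaf_of_ne (hu : Transcendental ℚ u) (hs1 : s - u ≠ 0) (hs2 : s * (s - u) - 1 ≠ 0)
    {w m : ℕ} (hw : w = 4 ∨ w = 7) : ∃ k ∈ Finset.Icc 1 16, ∀ (x : ℕ → K) (f : K),
      KernelEquations w m s u x f → x k = 0 →
        x 1 = 0 ∧ x 10 = 0 ∧ x 12 = 0 ∧ x 15 = 0 ∧ x 16 = 0 ∧ f = 0 := by
  classical
  have := algebraRat.charZero K
  have hu0 : u ≠ 0 := fun h => hu (h ▸ isAlgebraic_zero)
  have hpq : s ^ 3 - s * u ^ 2 - 3 * s + u ≠ 0 ∨ legSeq s 1 (s - u) (m + 1) ≠ 0 := by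
    by_cases hQ : s ^ 3 - s * u ^ 2 - 3 * s + u = 0
    · exact Or.inr (legSeq_ne_zero_of_cubic hu hQ m)
    · exact Or.inl hQ
  set P := s * (s * (s - u) - 1) - (s - u) with hP
  refine ⟨if P = 0 then 15 else if w = 4 then 10 else 1, by split_ifs <;> simp, ?_⟩
  rintro x f ⟨⟨h1, h2, h3, h5, h6, h8, h9, h10, h11, h12, h13, h14, h15, h16⟩, hf, ha⟩ hx
  have e2 : x 2 = (s - u) * x 1 := h1.symm
  have e3 : x 3 = (s * (s - u) - 1) * x 1 := by linear_combination -h2 + s * e2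
  have e11 : x 11 = (s - u) * x 12 := h12.symm
  have e12 : x 12 = x 1 := by
    refine mul_left_cancel₀ hs2 ?_
    linear_combination e3 + h11 - s * e11
  have e16 : x 16 = x 10 := mul_left_cancel₀ hs1 (h16.trans h10.symm)
  have e14 : x 14 = (s - u) * x 15 := h15.symm
  have e13 : x 13 = (s * (s - u) - 1) * x 15 := by linear_combination -h14 + s * e14
  have e6 : x 6 = P * x 15 := by linear_combination -h13 + s * e13 - e14
  have e9 : x 9 = (s - u) * x 10 := h10.symm
  have e8 : x 8 = ((s + u) * (s - u) - 2) * x 10 := by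
    linear_combination -h9 + (s + u) * e9 - e16
  have e4 : x 4 = (s ^ 3 - s * u ^ 2 - 3 * s + u) * x 1 := by
    linear_combination -h3 + (s + u) * e3 - e2 - e11 - (s - u) * e12
  rcases ha with ⟨rfl, h4, h7⟩ | ⟨rfl, h4, h7⟩
  · have e7 : x 7 = (s ^ 3 - s * u ^ 2 - 3 * s + u) * x 10 := by
      linear_combination -h8 + s * e8 - e9
    have e6' : x 6 = (s * (s ^ 3 - s * u ^ 2 - 3 * s + u) - ((s + u) * (s - u) - 2)) * x 10 := by
      linear_combination -h7 + s * e7 - e8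
    have hz : x 10 = 0 ∧ x 15 = 0 := by
      by_cases hP0 : P = 0
      · rw [if_pos hP0] at hx
        refine ⟨?_, hx⟩
        have : 2 * x 10 = 0 := by
          linear_combination (s ^ 3 + s ^ 2 * u - 3 * s - u) * x 10 * hP0 + (-s ^ 2 + 1) *
            (e6 - e6') + (-s ^ 2 + 1) * P * hx
        simpa using this
      · rw [if_neg hP0, if_pos rfl] at hx
        refine ⟨hx, (mul_eq_zero.mp (e6.symm.trans ?_)).resolve_left hP0⟩
        rw [e6', hx, mul_zero]
    obtain ⟨z10, z15⟩ := hz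
    simp only [z10, z15, mul_zero] at e6 e7 e8 e9 e13 e14 e16
    have e5 : x 5 = 0 := by linear_combination -h6 + (s + u) * e6 - e7 - e13
    have z4 : x 4 = 0 := by linear_combination -h5 + s * e5 - e6
    have hqf : (s * (s - u) - 1) * x 1 + legSeq s 1 (s - u) m * f = 0 := by
      linear_combination -h4 + (s + u) * z4 - e5 - e3
    have z : x 1 = 0 ∧ f = 0 := by
      rcases hpq with hQ | hp
      · have z1 : x 1 = 0 := (mul_eq_zero.mp (e4.symm.trans z4)).resolve_left hQ
        refine ⟨z1, eq_zero_of_legSeq_mul_eq_zero (s := s) (a := s - u) (k := m) ?_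
          (hf.symm.trans z4)⟩
        simpa [z1] using hqf
      · have zf : f = 0 := (mul_eq_zero.mp (hf.symm.trans z4)).resolve_left hp
        rw [zf, mul_zero, add_zero] at hqf
        exact ⟨(mul_eq_zero.mp hqf).resolve_left hs2, zf⟩
    exact ⟨z.1, z10, e12.trans z.1, z15, e16, z.2⟩
  · have e5 : x 5 = (s * (s ^ 3 - s * u ^ 2 - 3 * s + u) - (s * (s - u) - 1)) * x 1 := by
      linear_combination -h4 + s * e4 - e3
    have e6' : x 6 = (s * (s * (s ^ 3 - s * u ^ 2 - 3 * s + u) - (s * (s - u) - 1)) -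
        (s ^ 3 - s * u ^ 2 - 3 * s + u)) * x 1 := by
      linear_combination -h5 + s * e5 - e4
    have hz : x 1 = 0 ∧ x 15 = 0 := by
      by_cases hP0 : P = 0
      · rw [if_pos hP0] at hx
        refine ⟨?_, hx⟩
        have : 2 * u * x 1 = 0 := by
          linear_combination -(-s ^ 4 - s ^ 3 * u + 5 * s ^ 2 + 2 * s * u - 4) * x 1 * hP0 -
            (s ^ 2 - 2) * (e6 - e6') - (s ^ 2 - 2) * P * hx
        exact (mul_eq_zero.mp this).resolve_left (mul_ne_zero two_ne_zero hu0)
      · rw [if_neg hP0, if_neg (by norm_num)] at hx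
        refine ⟨hx, (mul_eq_zero.mp (e6.symm.trans ?_)).resolve_left hP0⟩
        rw [e6', hx, mul_zero]
    obtain ⟨z1, z15⟩ := hz
    simp only [z1, z15, mul_zero] at e3 e4 e5 e6 e12 e13
    have z7 : x 7 = 0 := by linear_combination -h6 + (s + u) * e6 - e5 - e13
    have e7 : (s ^ 3 - s * u ^ 2 - 3 * s + u) * x 10 = 0 := by
      linear_combination h8 - s * e8 + e9 + z7
    have hqf : x 8 + legSeq s 1 (s - u) m * f = 0 := by
      linear_combination -h7 + (s + u) * z7 - e6
    have z : x 10 = 0 ∧ f = 0 := by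
      rcases hpq with hQ | hp
      · have z10 : x 10 = 0 := (mul_eq_zero.mp e7).resolve_left hQ
        refine ⟨z10, eq_zero_of_legSeq_mul_eq_zero (s := s) (a := s - u) (k := m) ?_
          (hf.symm.trans z7)⟩
        simpa [e8, z10] using hqf
      · have zf : f = 0 := (mul_eq_zero.mp (hf.symm.trans z7)).resolve_left hp
        rw [zf, mul_zero, add_zero] at hqf
        refine ⟨(mul_eq_zero.mp (?_ : (s - u) * x 10 = 0)).resolve_left hs1, zf⟩
        linear_combination h10 - h8 + s * hqf - z7
    exact ⟨z1, z.1, e12, z15, e16.trans z.1, z.2⟩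

/-- Some leaf of `𝖳` detects all kernel vectors. -/
theorem exists_leaf (hu : Transcendental ℚ u) (s : K) {w : ℕ} (hw : w = 4 ∨ w = 7) (m : ℕ) :
    ∃ k ∈ Finset.Icc 1 16, ∀ (x : ℕ → K) (f : K),
      KernelEquations w m s u x f → x k = 0 → f = 0 ∧ ∀ i ∈ Finset.Icc 1 16, x i = 0 := by
  have : ∃ k ∈ Finset.Icc 1 16, ∀ (x : ℕ → K) (f : K),
      KernelEquations w m s u x f → x k = 0 →
        x 1 = 0 ∧ x 10 = 0 ∧ x 12 = 0 ∧ x 15 = 0 ∧ x 16 = 0 ∧ f = 0 := by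
    by_cases hs1 : s - u = 0
    · obtain rfl : s = u := sub_eq_zero.mp hs1
      exact ⟨10, by simp, fun x f => leaves_eq_zero_of_eq hu⟩
    by_cases hs2 : s * (s - u) - 1 = 0
    · exact ⟨1, by simp, fun x f => leaves_eq_zero_of_mul_eq_one hu (sub_eq_zero.mp hs2)⟩
    exact exists_leaf_of_ne hu hs1 hs2 hw
  obtain ⟨k, hk, h⟩ := this
  refine ⟨k, hk, fun x f hxf hx => ?_⟩
  obtain ⟨z1, z10, z12, z15, z16, zf⟩ := h x f hxf hx
  obtain ⟨⟨h1, h2, h3, h5, h6, h8, h9, h10, h11, h12, h13, h14, h15, h16⟩, hf, ha⟩ := hxf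
  have z2 : x 2 = 0 := by rw [← h1, z1, mul_zero]
  have z3 : x 3 = 0 := by linear_combination -h2 + s * z2 - z1
  have z11 : x 11 = 0 := by rw [← h12, z12, mul_zero]
  have z4 : x 4 = 0 := by linear_combination -h3 + (s + u) * z3 - z2 - z11
  have z14 : x 14 = 0 := by rw [← h15, z15, mul_zero]
  have z13 : x 13 = 0 := by linear_combination -h14 + s * z14 - z15
  have z6 : x 6 = 0 := by linear_combination -h13 + s * z13 - z14
  have z9 : x 9 = 0 := by rw [← h10, z10, mul_zero]
  have z8 : x 8 = 0 := by linear_combination -h9 + (s + u) * z9 - z10 - z16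
  have z7 : x 7 = 0 := by linear_combination -h8 + s * z8 - z9
  have z5 : x 5 = 0 := by linear_combination -h6 + (s + u) * z6 - z7 - z13
  refine ⟨zf, fun i hi => ?_⟩
  rw [Finset.mem_Icc] at hi
  obtain ⟨hi1, hi2⟩ := hi
  interval_cases i <;> assumption

end Kernel

section TreeGraph

open Matrix

theorem Polynomial.transcendental_mk_C {P : Ideal (Polynomial (RatFunc ℚ))} [P.IsMaximal]
    [Algebra ℚ (Polynomial (RatFunc ℚ) ⧸ P)] :
    Transcendental ℚ (Ideal.Quotient.mk P (Polynomial.C (RatFunc.X : RatFunc ℚ))) := by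
  let g : RatFunc ℚ →+* Polynomial (RatFunc ℚ) ⧸ P := (Ideal.Quotient.mk P).comp Polynomial.C
  have hg : Function.Injective g := g.injective
  have := RatFunc.transcendental_X (K := ℚ)
  intro h
  refine this ?_
  have h' : IsAlgebraic ℚ (g RatFunc.X) := h
  convert (isAlgebraic_algHom_iff g.toRatAlgHom hg).mp h' using 1
  exact Subsingleton.elim _ _

theorem charLmu_det_ne_zero {n : ℕ} (G : SimpleGraph (Fin n)) : (charLmu G).det ≠ 0 := by
  have : charLmu G = (G.adjMatrix (RatFunc ℚ) - (RatFunc.X : RatFunc ℚ) •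
      Matrix.diagonal (fun v => (G.degree v : RatFunc ℚ))).charmatrix := by
    ext i j : 2
    by_cases h : i = j
    · subst h
      simp [charLmu, Matrix.charmatrix]
    · by_cases h' : G.Adj i j <;>
        simp [charLmu, Matrix.charmatrix, h, h', SimpleGraph.adjMatrix_apply]
  rw [this]
  exact (Matrix.charpoly_monic _).ne_zero

theorem charLmu_map_mulVec_apply {n : ℕ} (G : SimpleGraph (Fin n)) {S : Type*} [CommRing S]
    (φ : Polynomial (RatFunc ℚ) →+* S) (x : Fin n → S) (i : Fin n) :
    ((charLmu G).map φ *ᵥ x) i = (φ Polynomial.X + G.degree i * φ (Polynomial.C RatFunc.X)) * x i -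
      ∑ j ∈ G.neighborFinset i, x j := by
  have : (charLmu G).map φ = φ Polynomial.X • 1 - (G.adjMatrix S -
      φ (Polynomial.C RatFunc.X) • Matrix.diagonal (fun v => (G.degree v : S))) := by
    ext k l
    by_cases h : k = l
    · subst h
      simp [charLmu]
    · by_cases h' : G.Adj k l <;> simp [charLmu, h, h', SimpleGraph.adjMatrix_apply]
  rw [this]
  simp [Matrix.sub_mulVec, Matrix.smul_mulVec, Matrix.mulVec_diagonal]
  ring

theorem treeGraph_adj {w m : ℕ} {i j : Fin (m + 16)} : (treeGraph w m).Adj i j ↔ i.val ≠ j.val ∧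
    (((i.val + 1, j.val + 1) ∈ baseEdges ∨ (i.val + 1 = w ∧ j.val + 1 = 17) ∨
      (17 ≤ i.val + 1 ∧ j.val + 1 = i.val + 2)) ∨
    ((j.val + 1, i.val + 1) ∈ baseEdges ∨ (j.val + 1 = w ∧ i.val + 1 = 17) ∨
      (17 ≤ j.val + 1 ∧ i.val + 1 = j.val + 2))) := by
  simp [treeGraph, Fin.ext_iff]

/-- Extension by zero of a vector on the vertices of `treeGraph w m` to all natural labels. -/
def labelled {K : Type*} [Zero K] {n : ℕ} (x : Fin n → K) (k : ℕ) : K :=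
  if h : 1 ≤ k ∧ k ≤ n then x ⟨k - 1, by omega⟩ else 0

theorem labelled_succ {K : Type*} [Zero K] {n : ℕ} (x : Fin n → K) (i : Fin n) :
    labelled x (i.val + 1) = x i := by
  rw [labelled, dif_pos (by omega)]
  rfl

theorem charLmu_row {n : ℕ} (G : SimpleGraph (Fin n)) {S : Type*} [CommRing S]
    {φ : Polynomial (RatFunc ℚ) →+* S} {x : Fin n → S} (hx : (charLmu G).map φ *ᵥ x = 0)
    (i : Fin n) (N : Finset ℕ) (hN : N ⊆ Finset.Icc 1 n)
    (h : ∀ j : Fin n, G.Adj i j ↔ j.val + 1 ∈ N) :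
    (φ Polynomial.X + N.card * φ (Polynomial.C RatFunc.X)) * labelled x (i.val + 1) =
      ∑ k ∈ N, labelled x k := by
  have hmap : N = (G.neighborFinset i).image (fun j => j.val + 1) := by
    ext k
    simp only [Finset.mem_image, SimpleGraph.mem_neighborFinset, h]
    refine ⟨fun hk => ?_, by rintro ⟨j, hj, rfl⟩; exact hj⟩
    have := Finset.mem_Icc.mp (hN hk)
    refine ⟨⟨k - 1, by omega⟩, ?_⟩
    have : k - 1 + 1 = k := by omega
    simpa [this] using hk
  have hinj : Function.Injective (fun j : Fin n => j.val + 1) := fun a b hab => by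
    simpa [Fin.ext_iff] using hab
  have hrow := congrFun hx i
  rw [charLmu_map_mulVec_apply, Pi.zero_apply, sub_eq_zero] at hrow
  rw [hmap, Finset.card_image_of_injective _ hinj, Finset.sum_image (fun a _ b _ => @hinj a b),
    SimpleGraph.card_neighborFinset_eq_degree]
  simpa only [labelled_succ] using hrow

theorem le_of_mem_baseEdges {a b : ℕ} (h : (a, b) ∈ baseEdges) : a ≤ 16 ∧ b ≤ 16 := by
  have : ∀ e ∈ baseEdges, e.1 ≤ 16 ∧ e.2 ≤ 16 := by decide
  exact this _ h

/-- The label of the `k`-th vertex of the attached path together with its attaching vertex,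
counted from the leaf. -/
def legLabel (w m k : ℕ) : ℕ := if k = m then w else m + 16 - k

theorem treeGraph_adj_leg {w m k : ℕ} (hw : w = 4 ∨ w = 7) (hk : k < m) (h : m + 15 - k < m + 16)
    (j : Fin (m + 16)) : (treeGraph w m).Adj ⟨m + 15 - k, h⟩ j ↔
      j.val + 1 = legLabel w m (k + 1) ∨ (0 < k ∧ j.val + 1 = legLabel w m (k - 1)) := by
  have h1 : (m + 15 - k + 1, j.val + 1) ∉ baseEdges := fun h => by
    have := le_of_mem_baseEdges h
    omega
  have h2 : (j.val + 1, m + 15 - k + 1) ∉ baseEdges := fun h => by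
    have := le_of_mem_baseEdges h
    omega
  obtain ⟨j, hj⟩ := j
  simp only [treeGraph_adj, h1, h2, legLabel, false_or]
  split_ifs <;> omega

section Quotient

variable {w m : ℕ} {S : Type*} [Field S] {φ : Polynomial (RatFunc ℚ) →+* S}
  {x : Fin (m + 16) → S}

/-- The value of a kernel vector on the attached path, in terms of its value at the leaf. -/
theorem labelled_legLabel (hw : w = 4 ∨ w = 7) (hm : 1 ≤ m)
    (hx : (charLmu (treeGraph w m)).map φ *ᵥ x = 0) (k : ℕ) (hk : k ≤ m) :
    labelled x (legLabel w m k) = legSeq (φ Polynomial.X + 2 * φ (Polynomial.C RatFunc.X)) 1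
      (φ Polynomial.X + φ (Polynomial.C RatFunc.X)) k * labelled x (m + 16) := by
  have hlab : ∀ k < m, legLabel w m k = m + 15 - k + 1 := fun k hk => by
    rw [legLabel, if_neg (by omega)]; omega
  have hmem : ∀ k ≤ m, legLabel w m k ∈ Finset.Icc 1 (m + 16) := fun k hk => by
    rw [legLabel, Finset.mem_Icc]; split_ifs <;> omega
  induction k using legSeq.induct with
  | case1 => simp [hlab 0 hm, legSeq]
  | case2 =>
    have := charLmu_row _ hx ⟨m + 15 - 0, by omega⟩ {legLabel w m 1} (by simpa using hmem 1 hk)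
      (fun j => by rw [treeGraph_adj_leg hw hm]; simp)
    simpa [legSeq] using this.symm
  | case3 k ih1 ih2 =>
    have hne : legLabel w m (k + 2) ≠ legLabel w m k := by
      rw [legLabel, legLabel]; split_ifs <;> omega
    have := charLmu_row _ hx ⟨m + 15 - (k + 1), by omega⟩ {legLabel w m (k + 2), legLabel w m k}
      (by simp [Finset.insert_subset_iff, hmem (k + 2) hk, hmem k (by omega), -Finset.mem_Icc])
      (fun j => by rw [treeGraph_adj_leg hw (show k + 1 < m by omega)]; simp)
    rw [Finset.card_pair hne, Finset.sum_pair hne] at this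
    simp only [← hlab (k + 1) (by omega), ih1 (by omega), ih2 (by omega), Nat.cast_ofNat] at this
    rw [legSeq]
    linear_combination -this

theorem baseEquations_labelled (hw : w = 4 ∨ w = 7)
    (hx : (charLmu (treeGraph w m)).map φ *ᵥ x = 0) :
    BaseEquations (φ Polynomial.X + 2 * φ (Polynomial.C RatFunc.X)) (φ (Polynomial.C RatFunc.X))
      (labelled x) := by
  have row : ∀ i (hi : i < m + 16) (N : Finset ℕ), N ⊆ Finset.Icc 1 16 →
      (∀ j (hj : j < m + 16), (treeGraph w m).Adj ⟨i, hi⟩ ⟨j, hj⟩ ↔ j + 1 ∈ N) → _ :=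
    fun i hi N hN h => charLmu_row _ hx ⟨i, hi⟩ N
      (hN.trans (Finset.Icc_subset_Icc le_rfl (by omega))) (fun j => h j j.2)
  have r1 := row 0 (by omega) {2} (by decide) (fun j hj => by
    rcases hw with rfl | rfl <;> simp [treeGraph_adj, baseEdges] <;> omega)
  have r2 := row 1 (by omega) {1, 3} (by decide) (fun j hj => by
    rcases hw with rfl | rfl <;> simp [treeGraph_adj, baseEdges] <;> omega)
  have r3 := row 2 (by omega) {2, 4, 11} (by decide) (fun j hj => by
    rcases hw with rfl | rfl <;> simp [treeGraph_adj, baseEdges] <;> omega)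
  have r5 := row 4 (by omega) {4, 6} (by decide) (fun j hj => by
    rcases hw with rfl | rfl <;> simp [treeGraph_adj, baseEdges] <;> omega)
  have r6 := row 5 (by omega) {5, 7, 13} (by decide) (fun j hj => by
    rcases hw with rfl | rfl <;> simp [treeGraph_adj, baseEdges] <;> omega)
  have r8 := row 7 (by omega) {7, 9} (by decide) (fun j hj => by
    rcases hw with rfl | rfl <;> simp [treeGraph_adj, baseEdges] <;> omega)
  have r9 := row 8 (by omega) {8, 10, 16} (by decide) (fun j hj => by
    rcases hw with rfl | rfl <;> simp [treeGraph_adj, baseEdges] <;> omega)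
  have r10 := row 9 (by omega) {9} (by decide) (fun j hj => by
    rcases hw with rfl | rfl <;> simp [treeGraph_adj, baseEdges] <;> omega)
  have r11 := row 10 (by omega) {3, 12} (by decide) (fun j hj => by
    rcases hw with rfl | rfl <;> simp [treeGraph_adj, baseEdges] <;> omega)
  have r12 := row 11 (by omega) {11} (by decide) (fun j hj => by
    rcases hw with rfl | rfl <;> simp [treeGraph_adj, baseEdges] <;> omega)
  have r13 := row 12 (by omega) {6, 14} (by decide) (fun j hj => by
    rcases hw with rfl | rfl <;> simp [treeGraph_adj, baseEdges] <;> omega)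
  have r14 := row 13 (by omega) {13, 15} (by decide) (fun j hj => by
    rcases hw with rfl | rfl <;> simp [treeGraph_adj, baseEdges] <;> omega)
  have r15 := row 14 (by omega) {14} (by decide) (fun j hj => by
    rcases hw with rfl | rfl <;> simp [treeGraph_adj, baseEdges] <;> omega)
  have r16 := row 15 (by omega) {9} (by decide) (fun j hj => by
    rcases hw with rfl | rfl <;> simp [treeGraph_adj, baseEdges] <;> omega)
  simp at r1 r2 r3 r5 r6 r8 r9 r10 r11 r12 r13 r14 r15 r16
  exact {
    h1 := by linear_combination r1
    h2 := by linear_combination r2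
    h3 := by linear_combination r3
    h5 := by linear_combination r5
    h6 := by linear_combination r6
    h8 := by linear_combination r8
    h9 := by linear_combination r9
    h10 := by linear_combination r10
    h11 := by linear_combination r11
    h12 := by linear_combination r12
    h13 := by linear_combination r13
    h14 := by linear_combination r14
    h15 := by linear_combination r15
    h16 := by linear_combination r16 }

theorem attachEquations_labelled (hw : w = 4 ∨ w = 7) (hm : 1 ≤ m)
    (hx : (charLmu (treeGraph w m)).map φ *ᵥ x = 0) :
    AttachEquations w (φ Polynomial.X + 2 * φ (Polynomial.C RatFunc.X))
      (φ (Polynomial.C RatFunc.X)) (labelled x) (labelled x 17) := by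
  have row : ∀ i (hi : i < m + 16) (N : Finset ℕ), N ⊆ Finset.Icc 1 17 →
      (∀ j (hj : j < m + 16), (treeGraph w m).Adj ⟨i, hi⟩ ⟨j, hj⟩ ↔ j + 1 ∈ N) → _ :=
    fun i hi N hN h => charLmu_row _ hx ⟨i, hi⟩ N
      (hN.trans (Finset.Icc_subset_Icc le_rfl (by omega))) (fun j => h j j.2)
  rcases hw with rfl | rfl
  · have r4 := row 3 (by omega) {3, 5, 17} (by decide) (fun j hj => by
      simp [treeGraph_adj, baseEdges]; omega)
    have r7 := row 6 (by omega) {6, 8} (by decide) (fun j hj => by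
      simp [treeGraph_adj, baseEdges]; omega)
    simp at r4 r7
    exact Or.inl ⟨rfl, by linear_combination r4, r7⟩
  · have r4 := row 3 (by omega) {3, 5} (by decide) (fun j hj => by
      simp [treeGraph_adj, baseEdges]; omega)
    have r7 := row 6 (by omega) {6, 8, 17} (by decide) (fun j hj => by
      simp [treeGraph_adj, baseEdges]; omega)
    simp at r4 r7
    exact Or.inr ⟨rfl, r4, by linear_combination r7⟩

theorem kernelEquations_labelled (hw : w = 4 ∨ w = 7)
    {x : Fin (m + 1 + 16) → S} (hx : (charLmu (treeGraph w (m + 1))).map φ *ᵥ x = 0) :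
    KernelEquations w m (φ Polynomial.X + 2 * φ (Polynomial.C RatFunc.X))
      (φ (Polynomial.C RatFunc.X)) (labelled x) (labelled x (m + 1 + 16)) := by
  have hsub : φ Polynomial.X + 2 * φ (Polynomial.C RatFunc.X) - φ (Polynomial.C RatFunc.X) =
      φ Polynomial.X + φ (Polynomial.C RatFunc.X) := by ring
  have hleg := labelled_legLabel hw (by omega) hx
  have h17 : legLabel w (m + 1) m = 17 := by rw [legLabel, if_neg (by omega)]; omega
  refine ⟨baseEquations_labelled hw hx, ?_, ?_⟩
  · simpa [hsub, legLabel] using hleg (m + 1) le_rfl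
  · rw [hsub, ← hleg m (by omega), h17]
    exact attachEquations_labelled hw (by omega) hx

theorem eq_zero_of_labelled_eq_zero (hw : w = 4 ∨ w = 7) (hm : 1 ≤ m)
    (hx : (charLmu (treeGraph w m)).map φ *ᵥ x = 0) (h0 : labelled x (m + 16) = 0)
    (h : ∀ i ∈ Finset.Icc 1 16, labelled x i = 0) : x = 0 := by
  funext i
  rw [Pi.zero_apply, ← labelled_succ x i]
  rcases Nat.lt_or_ge i.val 16 with hi | hi
  · exact h _ (by simp; omega)
  · have := labelled_legLabel hw hm hx (m + 15 - i) (by omega)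
    rw [h0, mul_zero, legLabel, if_neg (by omega)] at this
    rwa [show m + 16 - (m + 15 - i.val) = i.val + 1 by omega] at this

end Quotient

theorem unimodularEquiv_charLmu_treeGraph {w m : ℕ} (hw : w = 4 ∨ w = 7) (hm : 1 ≤ m) :
    UnimodularEquiv (charLmu (treeGraph w m))
      (diagonal fun k => if k = Fin.last (m + 15) then (charLmu (treeGraph w m)).det else 1) := by
  obtain ⟨m, rfl⟩ := Nat.exists_eq_add_of_le' hm
  refine unimodularEquiv_diagonal_det _ (charLmu_det_ne_zero _) (fun P _ => ?_) _
  let := Ideal.Quotient.field P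
  obtain ⟨k, hk, h⟩ := exists_leaf (Polynomial.transcendental_mk_C (P := P))
    (Ideal.Quotient.mk P Polynomial.X + 2 * Ideal.Quotient.mk P (Polynomial.C RatFunc.X)) hw m
  rw [Finset.mem_Icc] at hk
  refine ⟨⟨k - 1, by omega⟩, fun x hx hxk => ?_⟩
  obtain ⟨h0, h1⟩ := h _ _ (kernelEquations_labelled hw hx) (by
    rwa [labelled, dif_pos (by omega)])
  exact eq_zero_of_labelled_eq_zero hw hm hx h0 h1

end TreeGraph

/-- For `m ≥ 1` and each of the two trees obtained from `𝖳` by attaching the path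
`17–⋯–(16+m)` at vertex `4` or at vertex `7`, the ideal of `ℚ(μ)[t]` generated by all
`(n-1) × (n-1)` minors of `t I - L_μ(Gᵢ)` is the unit ideal; consequently the Smith
normal form of `t I - L_μ(Gᵢ)` over `ℚ(μ)[t]` is `diag(1, …, 1, det(t I - L_μ(Gᵢ)))`. -/
theorem stmt5 (m : ℕ) (hm : 1 ≤ m) (w : ℕ) (hw : w = 4 ∨ w = 7) :
    (Ideal.span {d : Polynomial (RatFunc ℚ) |
        ∃ i j : Fin (m + 16),
          d = ((charLmu (treeGraph w m)).submatrix i.succAbove j.succAbove).det} = ⊤) ∧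
    ∃ U W : Matrix (Fin (m + 16)) (Fin (m + 16)) (Polynomial (RatFunc ℚ)),
      IsUnit U.det ∧ IsUnit W.det ∧
      U * charLmu (treeGraph w m) * W =
        Matrix.diagonal (fun k : Fin (m + 16) =>
          if k = Fin.last (m + 15) then (charLmu (treeGraph w m)).det else 1) := by
  have h := unimodularEquiv_charLmu_treeGraph hw hm
  exact ⟨Matrix.span_minors_eq_top _ _ _ h, h⟩
end

section
/- Let m ≥ 1, n = 16 + m, and let G₁ and G₂ be the trees on n vertices obtained from 𝖳 by attaching the path 17–18–⋯–n at vertex 4 and at vertex 7, respectively. Then tI − L_μ(G₁) and tI − L_μ(G₂) have the same Smith normal form over ℚ(μ)[t] (they are equivalent via matrices invertible over ℚ(μ)[t]), yet G₁ and G₂ are not degree-similar: there is no invertible real matrix M with M⁻¹A(G₁)M = A(G₂) and M⁻¹D(G₁)M = D(G₂). -/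
open scoped Classical

/-- The diagonal degree matrix of a graph, over `ℝ`. -/
noncomputable def degMatrix {V : Type*} [Fintype V] [DecidableEq V] (G : SimpleGraph V) :
    Matrix V V ℝ :=
  Matrix.diagonal fun v => (G.degree v : ℝ)

/-- Two graphs on a common vertex set are degree-similar if some invertible real matrix
simultaneously conjugates the adjacency matrix of one to that of the other, and the
degree matrix of one to that of the other. -/
noncomputable def DegreeSimilar {V : Type*} [Fintype V] [DecidableEq V]
    (G₁ G₂ : SimpleGraph V) : Prop :=
  ∃ M : Matrix V V ℝ, IsUnit M.det ∧
    M⁻¹ * G₁.adjMatrix ℝ * M = G₂.adjMatrix ℝ ∧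
    M⁻¹ * degMatrix G₁ * M = degMatrix G₂

section Reflection

variable {n k F : Type*} [Fintype n] [DecidableEq n] [Fintype k] [DecidableEq k] [Field F]

/-- The reflection `1 - 2 P`, where `P` is the orthogonal projection onto the column space
of `K`. -/
noncomputable def colReflection (K : Matrix n k F) : Matrix n n F :=
  1 - (2 : F) • (K * (K.transpose * K)⁻¹ * K.transpose)

lemma colReflection_transpose (K : Matrix n k F) :
    (colReflection K).transpose = colReflection K := by
  simp [colReflection, Matrix.transpose_mul, Matrix.transpose_nonsing_inv, Matrix.mul_assoc]

lemma colReflection_mul_self (K : Matrix n k F) (hK : IsUnit (K.transpose * K).det) :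
    colReflection K * colReflection K = 1 := by
  have h : (K * (K.transpose * K)⁻¹ * K.transpose) * (K * (K.transpose * K)⁻¹ * K.transpose) =
      K * (K.transpose * K)⁻¹ * K.transpose := by
    calc _ = K * ((K.transpose * K)⁻¹ * (K.transpose * K)) * (K.transpose * K)⁻¹ * K.transpose := by
          simp only [Matrix.mul_assoc]
      _ = _ := by rw [Matrix.nonsing_inv_mul _ hK, Matrix.mul_one]
  simp only [colReflection, sub_mul, mul_sub, Matrix.one_mul, Matrix.mul_one, Matrix.smul_mul,
    Matrix.mul_smul, h]
  module

lemma colReflection_commute (K : Matrix n k F) (hK : IsUnit (K.transpose * K).det)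
    {S : Matrix n n F} (hS : S.transpose = S) {C : Matrix k k F} (hC : S * K = K * C) :
    colReflection K * S = S * colReflection K := by
  have hC' : K.transpose * S = C.transpose * K.transpose := by
    rw [← Matrix.transpose_mul, ← hC, Matrix.transpose_mul, hS]
  have hG : C.transpose * (K.transpose * K) = K.transpose * K * C := by
    rw [← Matrix.mul_assoc, ← hC', Matrix.mul_assoc, hC, Matrix.mul_assoc]
  have hG' : (K.transpose * K)⁻¹ * C.transpose = C * (K.transpose * K)⁻¹ := by
    calc _ = (K.transpose * K)⁻¹ * (C.transpose * (K.transpose * K)) * (K.transpose * K)⁻¹ := by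
          rw [Matrix.mul_assoc, Matrix.mul_assoc, Matrix.mul_nonsing_inv _ hK, Matrix.mul_one]
      _ = _ := by
          rw [hG, ← Matrix.mul_assoc, Matrix.nonsing_inv_mul _ hK, Matrix.one_mul]
  have h : (K * (K.transpose * K)⁻¹ * K.transpose) * S =
      S * (K * (K.transpose * K)⁻¹ * K.transpose) := by
    calc _ = K * ((K.transpose * K)⁻¹ * C.transpose) * K.transpose := by
          rw [Matrix.mul_assoc, hC']; simp only [Matrix.mul_assoc]
      _ = S * K * (K.transpose * K)⁻¹ * K.transpose := by
          rw [hG', hC]; simp only [Matrix.mul_assoc]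
      _ = _ := by simp only [Matrix.mul_assoc]
  simp only [colReflection, sub_mul, mul_sub, Matrix.one_mul, Matrix.mul_one, Matrix.smul_mul,
    Matrix.mul_smul, h]

lemma colReflection_mulVec [NeZero (2 : F)] (K : Matrix n k F)
    (hK : IsUnit (K.transpose * K).det)
    {x y : n → F} {c : k → F} (hsub : x - y = K.mulVec c)
    (hadd : K.transpose.mulVec (x + y) = 0) :
    (colReflection K).mulVec x = y := by
  have h2 : (2 : F) • x = (x + y) + K.mulVec c := by rw [← hsub]; module
  have h : (K * (K.transpose * K)⁻¹ * K.transpose).mulVec ((2 : F) • x) = x - y := by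
    rw [h2, Matrix.mulVec_add, ← Matrix.mulVec_mulVec, hadd, Matrix.mulVec_zero, zero_add,
      Matrix.mulVec_mulVec, Matrix.mul_assoc, Matrix.mul_assoc,
      Matrix.nonsing_inv_mul _ hK, Matrix.mul_one, hsub]
  rw [colReflection, Matrix.sub_mulVec, Matrix.one_mulVec, Matrix.smul_mulVec,
    ← Matrix.mulVec_smul, h]
  abel

end Reflection

/-- The adjacency relation of `𝖳`, with vertices shifted to `0, …, 15`. -/
def baseAdj (i j : ℕ) : Bool :=
  decide ((i + 1, j + 1) ∈ baseEdges ∨ (j + 1, i + 1) ∈ baseEdges)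

/-- The degrees of `𝖳`. -/
def baseDegree (i : Fin 16) : ℕ := ∑ j : Fin 16, if baseAdj i j then 1 else 0

lemma baseEdges_bound : ∀ p ∈ baseEdges, p.1 ≤ 16 ∧ p.2 ≤ 16 ∧ p.1 ≠ p.2 := by decide

/-- The inclusion of the vertices of `𝖳`. -/
def baseVertex (m : ℕ) : Fin 16 → Fin (m + 16) := Fin.castLE (by omega)

@[simp] lemma baseVertex_val (m : ℕ) (i : Fin 16) : (baseVertex m i).val = i.val := rfl

lemma baseVertex_injective (m : ℕ) : Function.Injective (baseVertex m) :=
  Fin.castLE_injective _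

lemma le_of_notMem_range_baseVertex {m : ℕ} {i : Fin (m + 16)}
    (hi : i ∉ Set.range (baseVertex m)) : 16 ≤ i.val := by
  by_contra! h
  exact hi ⟨⟨i.val, h⟩, rfl⟩

lemma sum_eq_sum_baseVertex {m : ℕ} {R : Type*} [AddCommMonoid R] (f : Fin (m + 16) → R)
    (hf : ∀ i, 16 ≤ i.val → f i = 0) : ∑ i, f i = ∑ i, f (baseVertex m i) :=
  (Fintype.sum_of_injective (baseVertex m) (baseVertex_injective m) _ f
    (fun _ hi => hf _ (le_of_notMem_range_baseVertex hi)) fun _ => rfl).symm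

lemma treeGraph_zero_adj_base {m : ℕ} (i j : Fin 16) :
    (treeGraph 0 m).Adj (baseVertex m i) (baseVertex m j) ↔ baseAdj i j := by
  simp only [treeGraph, SimpleGraph.fromRel_adj, baseVertex_val, baseAdj, decide_eq_true_eq, ne_eq]
  have h1 := baseEdges_bound (i + 1, j + 1)
  have h2 := baseEdges_bound (j + 1, i + 1)
  have hij : baseVertex m i = baseVertex m j ↔ i.val = j.val := by
    rw [(baseVertex_injective m).eq_iff, Fin.ext_iff]
  have := i.isLt
  have := j.isLt
  grind

lemma treeGraph_zero_not_adj_base {m : ℕ} {i j : Fin (m + 16)} (hi : 16 ≤ i.val)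
    (hj : j.val < 16) : ¬ (treeGraph 0 m).Adj i j := by
  simp only [treeGraph, SimpleGraph.fromRel_adj]
  have h1 := baseEdges_bound (i + 1, j + 1)
  have h2 := baseEdges_bound (j + 1, i + 1)
  grind

lemma treeGraph_succ_adj {m w : ℕ} (hw : w < 16) (i j : Fin (m + 16)) :
    (treeGraph (w + 1) m).Adj i j ↔
      (treeGraph 0 m).Adj i j ∨ (i.val = w ∧ j.val = 16) ∨ (i.val = 16 ∧ j.val = w) := by
  simp only [treeGraph, SimpleGraph.fromRel_adj, ne_eq, Fin.ext_iff]
  grind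

lemma treeGraph_degree_le_two {m w : ℕ} (hw : w ≤ 16) {v : Fin (m + 16)} (hv : 16 ≤ v.val) :
    (treeGraph w m).degree v ≤ 2 := by
  rw [← SimpleGraph.card_neighborFinset_eq_degree,
    ← Finset.card_image_of_injective _ Fin.val_injective]
  refine (Finset.card_le_card (t := {if v.val = 16 then w - 1 else v.val - 1, v.val + 1})
    fun x hx => ?_).trans Finset.card_le_two
  obtain ⟨u, hu, rfl⟩ := Finset.mem_image.1 hx
  rw [SimpleGraph.mem_neighborFinset] at hu
  simp only [treeGraph, SimpleGraph.fromRel_adj] at hu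
  have h1 := baseEdges_bound (u + 1, v + 1)
  have h2 := baseEdges_bound (v + 1, u + 1)
  grind

lemma treeGraph_succ_adjMatrix {m w : ℕ} (hw : w < 16) (R : Type*) [CommRing R]
    {a b : Fin (m + 16)} (ha : a.val = w) (hb : b.val = 16) :
    (treeGraph (w + 1) m).adjMatrix R = (treeGraph 0 m).adjMatrix R +
      Matrix.vecMulVec (Pi.single a 1) (Pi.single b 1) +
      Matrix.vecMulVec (Pi.single b 1) (Pi.single a 1) := by
  ext i j
  have h1 := treeGraph_zero_not_adj_base (m := m) (i := b) (j := a) (by omega) (by omega)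
  have h2 : ¬ (treeGraph 0 m).Adj a b := fun h => h1 h.symm
  have h3 := treeGraph_succ_adj hw i j
  have h4 : (i.val = w ↔ i = a) ∧ (i.val = 16 ↔ i = b) ∧ (j.val = w ↔ j = a) ∧
    (j.val = 16 ↔ j = b) := by simp only [Fin.ext_iff, ha, hb]; tauto
  have hab : a ≠ b := by intro h; rw [h] at ha; omega
  simp only [SimpleGraph.adjMatrix_apply, Matrix.add_apply, Matrix.vecMulVec_apply,
    Pi.single_apply]
  obtain ⟨e1, e2, e3, e4⟩ := h4
  rw [e1, e2, e3, e4] at h3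
  simp only [h3]
  by_cases i1 : i = a <;> by_cases i2 : i = b <;> by_cases j1 : j = a <;> by_cases j2 : j = b <;>
    simp_all

lemma treeGraph_succ_degree {m w : ℕ} (hw : w < 16) (R : Type*) [CommRing R]
    {a b : Fin (m + 16)} (ha : a.val = w) (hb : b.val = 16) (v : Fin (m + 16)) :
    ((treeGraph (w + 1) m).degree v : R) = (treeGraph 0 m).degree v +
      (if v = a then 1 else 0) + (if v = b then 1 else 0) := by
  have h (G : SimpleGraph (Fin (m + 16))) : (G.degree v : R) = ∑ j, G.adjMatrix R v j := by
    simp only [SimpleGraph.adjMatrix_apply]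
    convert SimpleGraph.degree_eq_sum_if_adj (R := R) G v
  rw [h, h, treeGraph_succ_adjMatrix hw R ha hb]
  simp [Finset.sum_add_distrib, Matrix.vecMulVec_apply, Pi.single_apply]

lemma treeGraph_zero_degree_base {m : ℕ} (i : Fin 16) :
    (treeGraph 0 m).degree (baseVertex m i) = baseDegree i := by
  have h := SimpleGraph.degree_eq_sum_if_adj (R := ℕ) (treeGraph 0 m) (baseVertex m i)
  rw [Nat.cast_id] at h
  rw [h, sum_eq_sum_baseVertex, baseDegree]
  · simp only [treeGraph_zero_adj_base]
  · intro j hj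
    rw [if_neg]
    exact fun h => treeGraph_zero_not_adj_base hj i.isLt h.symm

/-- The matrix `L_μ(G) = A(G) - μ D(G)`. -/
noncomputable def lmu {n : ℕ} {R : Type*} [CommRing R] (μ : R)
    (G : SimpleGraph (Fin n)) : Matrix (Fin n) (Fin n) R :=
  G.adjMatrix R - μ • Matrix.diagonal fun v => (G.degree v : R)

lemma lmu_transpose {n : ℕ} {R : Type*} [CommRing R] (μ : R) (G : SimpleGraph (Fin n)) :
    (lmu μ G).transpose = lmu μ G := by
  simp [lmu]

lemma lmu_treeGraph_succ {m w : ℕ} (hw : w < 16) {R : Type*} [CommRing R] (μ : R)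
    {a b : Fin (m + 16)} (ha : a.val = w) (hb : b.val = 16) :
    lmu μ (treeGraph (w + 1) m) = lmu μ (treeGraph 0 m) +
      Matrix.vecMulVec (Pi.single a 1) (Pi.single b 1) +
      Matrix.vecMulVec (Pi.single b 1) (Pi.single a 1) -
      μ • (Matrix.vecMulVec (Pi.single a 1) (Pi.single a 1) +
        Matrix.vecMulVec (Pi.single b 1) (Pi.single b 1)) := by
  have hD : (Matrix.diagonal fun v => ((treeGraph (w + 1) m).degree v : R)) =
      (Matrix.diagonal fun v => ((treeGraph 0 m).degree v : R)) +
        (Matrix.vecMulVec (Pi.single a 1) (Pi.single a 1) +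
          Matrix.vecMulVec (Pi.single b 1) (Pi.single b 1)) := by
    ext i j
    have := treeGraph_succ_degree hw R ha hb i
    by_cases hij : i = j
    · subst hij
      simp only [Matrix.diagonal_apply_eq, Matrix.add_apply, this, Matrix.vecMulVec_apply,
        Pi.single_apply]
      split_ifs <;> simp [add_assoc]
    · simp only [Matrix.diagonal_apply_ne _ hij, Matrix.add_apply, Matrix.vecMulVec_apply,
        Pi.single_apply]
      split_ifs <;> simp_all
  rw [lmu, lmu, treeGraph_succ_adjMatrix hw R ha hb, hD]
  module

/-- A basis (in columns) of the cyclic module generated by `e₄ - e₇` under `L_μ(𝖳)`. -/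
def baseKrylov {R : Type*} [CommRing R] (μ : R) : Matrix (Fin 16) (Fin 5) R :=
  !![0, 0, 0, 1, 0;
     0, 0, 1, 0, 0;
     0, 1, 0, 0, 0;
     1, 0, 0, 0, 0;
     0, 1, μ - 1, -1, -1;
     0, -1, 1, 0, 1;
     -1, 0, 0, 0, 0;
     0, -1, -μ, 1, 0;
     0, 0, -1, 0, 0;
     0, 0, 0, -1, 0;
     0, 0, 1, 0, 0;
     0, 0, 0, 1, 0;
     0, 0, -1, 1, μ;
     0, 0, 0, -1, -1 - μ;
     0, 0, 0, 0, 1;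
     0, 0, 0, -1, 0]

/-- The action of `L_μ(𝖳)` on the columns of `baseKrylov μ`. -/
def krylovAction {R : Type*} [CommRing R] (μ : R) : Matrix (Fin 5) (Fin 5) R :=
  !![-2 * μ, 2, μ - 1, -1, -1;
     1, -3 * μ, 2, 0, 0;
     0, 1, -2 * μ, 1, 0;
     0, 0, 1, -μ, 0;
     0, 0, 0, -1, -1 - 2 * μ]

lemma baseDegree_eq :
    baseDegree = ![1, 2, 3, 2, 2, 3, 2, 2, 3, 1, 2, 1, 2, 2, 1, 1] := by decide

lemma sum_baseAdj {R : Type*} [AddCommMonoid R] (x : Fin 16 → R) :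
    (fun i : Fin 16 => ∑ k : Fin 16, if baseAdj i k then x k else 0) =
      ![x 1, x 0 + x 2, x 1 + x 3 + x 10, x 2 + x 4, x 3 + x 5, x 4 + x 6 + x 12, x 5 + x 7,
        x 6 + x 8, x 7 + x 9 + x 15, x 8, x 2 + x 11, x 10, x 5 + x 13, x 12 + x 14, x 13,
        x 8] := by
  ext i
  fin_cases i <;>
    simp [baseAdj, baseEdges, Fin.sum_univ_succ, add_assoc]

set_option maxHeartbeats 2000000 in
lemma baseKrylov_action {R : Type*} [CommRing R] (μ : R) (i : Fin 16) (j : Fin 5) :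
    (∑ k : Fin 16, if baseAdj i k then baseKrylov μ k j else 0) -
      μ * (baseDegree i * baseKrylov μ i j) = (baseKrylov μ * krylovAction μ) i j := by
  have h := congrFun (sum_baseAdj fun k => baseKrylov μ k j) i
  rw [h, baseDegree_eq, Matrix.mul_apply, Fin.sum_univ_five]
  fin_cases i <;> fin_cases j <;> simp [baseKrylov, krylovAction] <;> ring

lemma baseKrylov_map {R S : Type*} [CommRing R] [CommRing S] (f : R →+* S) (μ : R) :
    (baseKrylov μ).map f = baseKrylov (f μ) := by
  ext i j
  fin_cases i <;> fin_cases j <;> simp [baseKrylov]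

lemma det_gram_baseKrylov_map {R S : Type*} [CommRing R] [CommRing S] (f : R →+* S) (μ : R) :
    ((baseKrylov (f μ)).transpose * baseKrylov (f μ)).det =
      f ((baseKrylov μ).transpose * baseKrylov μ).det := by
  rw [RingHom.map_det, RingHom.mapMatrix_apply, Matrix.map_mul, Matrix.transpose_map,
    baseKrylov_map]

lemma det_gram_baseKrylov_zero :
    ((baseKrylov (0 : ℚ)).transpose * baseKrylov (0 : ℚ)).det ≠ 0 := by
  have h : (baseKrylov (0 : ℚ)).transpose * baseKrylov (0 : ℚ) =
      !![2, 0, 0, 0, 0; 0, 4, -2, -2, -2; 0, -2, 6, 0, 2; 0, -2, 0, 8, 2; 0, -2, 2, 2, 4] := by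
    ext i j
    fin_cases i <;> fin_cases j <;>
      simp [baseKrylov, Matrix.mul_apply, Fin.sum_univ_succ] <;> norm_num
  rw [h]
  simp [Matrix.det_succ_row_zero, Fin.sum_univ_succ, Fin.succAbove]
  norm_num

lemma isUnit_det_gram_baseKrylov :
    IsUnit ((baseKrylov (RatFunc.X : RatFunc ℚ)).transpose *
      baseKrylov (RatFunc.X : RatFunc ℚ)).det := by
  rw [isUnit_iff_ne_zero, ← RatFunc.algebraMap_X, det_gram_baseKrylov_map]
  intro h
  rw [map_eq_zero_iff _ (RatFunc.algebraMap_injective ℚ)] at h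
  apply det_gram_baseKrylov_zero
  have := det_gram_baseKrylov_map (Polynomial.evalRingHom (0 : ℚ)) Polynomial.X
  rw [h, map_zero] at this
  simpa using this

/-- Extension by zero of a matrix with rows indexed by the vertices of `𝖳`. -/
def extendRows {R k : Type*} [Zero R] (m : ℕ) (K : Matrix (Fin 16) k R) :
    Matrix (Fin (m + 16)) k R :=
  Matrix.of fun i j => if h : i.val < 16 then K ⟨i.val, h⟩ j else 0

section ExtendRows

variable {R k : Type*} {m : ℕ}

@[simp] lemma extendRows_baseVertex [Zero R] (K : Matrix (Fin 16) k R) (i : Fin 16) (j : k) :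
    extendRows m K (baseVertex m i) j = K i j := by
  simp [extendRows]

lemma extendRows_of_le [Zero R] (K : Matrix (Fin 16) k R) {i : Fin (m + 16)}
    (hi : 16 ≤ i.val) (j : k) : extendRows m K i j = 0 := by
  simp [extendRows, hi]

lemma extendRows_transpose_mul_self [CommRing R] (K : Matrix (Fin 16) k R) :
    (extendRows m K).transpose * extendRows m K = K.transpose * K := by
  ext i j
  rw [Matrix.mul_apply, Matrix.mul_apply, sum_eq_sum_baseVertex]
  · simp
  · intro l hl
    rw [extendRows_of_le K hl, mul_zero]

lemma extendRows_mul [CommRing R] [Fintype k] (K : Matrix (Fin 16) k R) (C : Matrix k k R) :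
    extendRows m K * C = extendRows m (K * C) := by
  ext i j
  by_cases hi : i.val < 16 <;> simp [extendRows, Matrix.mul_apply, hi]

end ExtendRows

lemma lmu_mul_extendRows_baseKrylov {R : Type*} [CommRing R] (m : ℕ) (μ : R) :
    lmu μ (treeGraph 0 m) * extendRows m (baseKrylov μ) =
      extendRows m (baseKrylov μ) * krylovAction μ := by
  rw [extendRows_mul]
  ext i j
  rw [Matrix.mul_apply, sum_eq_sum_baseVertex _ fun l hl => by
    rw [extendRows_of_le _ hl, mul_zero]]
  simp only [extendRows_baseVertex, lmu, Matrix.sub_apply, SimpleGraph.adjMatrix_apply,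
    Matrix.smul_apply, smul_eq_mul]
  rcases lt_or_ge i.val 16 with hi | hi
  · obtain ⟨i, rfl⟩ : ∃ i', baseVertex m i' = i := ⟨⟨i.val, hi⟩, rfl⟩
    rw [extendRows_baseVertex, ← baseKrylov_action]
    simp only [treeGraph_zero_adj_base, sub_mul, Finset.sum_sub_distrib, ite_mul, one_mul,
      zero_mul, Matrix.diagonal_apply, (baseVertex_injective m).eq_iff, mul_ite, mul_zero,
      Finset.sum_ite_eq, Finset.mem_univ, if_true, treeGraph_zero_degree_base, mul_assoc]
  · rw [extendRows_of_le _ hi]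
    refine Finset.sum_eq_zero fun l _ => ?_
    rw [if_neg (treeGraph_zero_not_adj_base hi l.isLt), Matrix.diagonal_apply_ne]
    · simp
    · rintro rfl
      exact absurd l.isLt (not_lt.2 hi)

lemma treeGraph_four_seven_conj {m : ℕ} (hm : 1 ≤ m) {F : Type*} [Field F] [NeZero (2 : F)]
    (μ : F) (hK : IsUnit ((baseKrylov μ).transpose * baseKrylov (μ : F)).det) :
    ∃ Q : Matrix (Fin (m + 16)) (Fin (m + 16)) F, Q * Q = 1 ∧
      Q * lmu μ (treeGraph 4 m) * Q = lmu μ (treeGraph 7 m) := by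
  set K := extendRows m (baseKrylov μ) with hKdef
  have hK' : IsUnit (K.transpose * K).det := by rwa [hKdef, extendRows_transpose_mul_self]
  have hQQ := colReflection_mul_self K hK'
  refine ⟨colReflection K, hQQ, ?_⟩
  set Q := colReflection K with hQ
  have hcomm : Q * lmu μ (treeGraph 0 m) = lmu μ (treeGraph 0 m) * Q :=
    colReflection_commute K hK' (lmu_transpose _ _) (lmu_mul_extendRows_baseKrylov m μ)
  set b : Fin (m + 16) := ⟨16, by omega⟩ with hb
  have hQa : Q.mulVec (Pi.single (baseVertex m 3) 1) = Pi.single (baseVertex m 6) 1 := by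
    refine colReflection_mulVec K hK' (c := Pi.single 0 1) ?_ ?_
    · rw [Matrix.mulVec_single_one]
      ext i
      rcases lt_or_ge i.val 16 with hi | hi
      · obtain ⟨i, rfl⟩ : ∃ i', baseVertex m i' = i := ⟨⟨i.val, hi⟩, rfl⟩
        simp only [Pi.sub_apply, Pi.single_apply, (baseVertex_injective m).eq_iff,
          Matrix.col_apply, hKdef, extendRows_baseVertex]
        fin_cases i <;> simp [baseKrylov]
      · have h (l : Fin 16) : i ≠ baseVertex m l := by
          rintro rfl
          exact absurd l.isLt (not_lt.2 hi)
        simp [Matrix.col_apply, hKdef, extendRows_of_le _ hi, h]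
    · rw [Matrix.mulVec_add, Matrix.mulVec_single_one, Matrix.mulVec_single_one]
      ext j
      simp only [Pi.add_apply, Matrix.col_apply, Matrix.transpose_apply, hKdef,
        extendRows_baseVertex]
      fin_cases j <;> simp [baseKrylov]
  have hQb : Q.mulVec (Pi.single b 1) = Pi.single b 1 := by
    refine colReflection_mulVec K hK' (c := 0) (by simp) ?_
    rw [Matrix.mulVec_add, Matrix.mulVec_single_one]
    ext j
    simp [hKdef, extendRows_of_le _ (show 16 ≤ b.val from le_rfl)]
  have hQt (x : Fin (m + 16) → F) : Matrix.vecMul x Q = Q.mulVec x := by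
    rw [← Matrix.mulVec_transpose, colReflection_transpose]
  rw [lmu_treeGraph_succ (w := 3) (by norm_num) μ (a := baseVertex m 3) (b := b) rfl rfl,
    lmu_treeGraph_succ (w := 6) (by norm_num) μ (a := baseVertex m 6) (b := b) rfl rfl]
  simp only [mul_add, add_mul, mul_sub, sub_mul, Matrix.mul_smul, Matrix.smul_mul,
    Matrix.mul_vecMulVec, Matrix.vecMulVec_mul, hQt, hQa, hQb]
  rw [hcomm, Matrix.mul_assoc, hQQ, Matrix.mul_one]

lemma charLmu_eq {n : ℕ} (G : SimpleGraph (Fin n)) :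
    charLmu G = (Polynomial.X : Polynomial (RatFunc ℚ)) • 1 -
      (lmu RatFunc.X G).map Polynomial.C := by
  ext1 i j
  simp only [charLmu, lmu, Matrix.sub_apply, Matrix.map_apply, Matrix.smul_apply,
    SimpleGraph.adjMatrix_apply, smul_eq_mul, map_sub, map_mul, Matrix.diagonal_apply]
  split_ifs <;> simp

lemma charLmu_conj {n : ℕ} {G₁ G₂ : SimpleGraph (Fin n)}
    {Q : Matrix (Fin n) (Fin n) (RatFunc ℚ)} (hQ : Q * Q = 1)
    (h : Q * lmu RatFunc.X G₁ * Q = lmu RatFunc.X G₂) :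
    IsUnit (Q.map Polynomial.C).det ∧
      Q.map Polynomial.C * charLmu G₁ * Q.map Polynomial.C = charLmu G₂ := by
  have hQ' : Q.map Polynomial.C * Q.map Polynomial.C = 1 := by
    rw [← Matrix.map_mul, hQ]; simp
  refine ⟨(Matrix.isUnit_iff_isUnit_det _).1 (IsUnit.of_mul_eq_one _ hQ'), ?_⟩
  rw [charLmu_eq, charLmu_eq, ← h, Matrix.map_mul, Matrix.map_mul, mul_sub, sub_mul,
    Matrix.mul_smul, Matrix.smul_mul, Matrix.mul_one, hQ']

lemma baseVertex_ne {m : ℕ} {b : Fin (m + 16)} (hb : 16 ≤ b.val) (i : Fin 16) :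
    baseVertex m i ≠ b := by
  rintro rfl
  exact absurd i.isLt (not_lt.2 hb)

section Intertwine

variable {m : ℕ} {M : Matrix (Fin (m + 16)) (Fin (m + 16)) ℝ}

lemma adjMatrix_zero_mul_baseVertex (M : Matrix (Fin (m + 16)) (Fin (m + 16)) ℝ) (i : Fin 16)
    (j : Fin (m + 16)) :
    ((treeGraph 0 m).adjMatrix ℝ * M) (baseVertex m i) j =
      ∑ k : Fin 16, if baseAdj i k then M (baseVertex m k) j else 0 := by
  rw [Matrix.mul_apply, sum_eq_sum_baseVertex]
  · simp only [SimpleGraph.adjMatrix_apply, treeGraph_zero_adj_base, ite_mul, one_mul, zero_mul]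
  · intro l hl
    rw [SimpleGraph.adjMatrix_apply,
      if_neg fun h => treeGraph_zero_not_adj_base hl i.isLt h.symm, zero_mul]

lemma adjMatrix_zero_mul_of_le {b j : Fin (m + 16)} (hb : 16 ≤ b.val)
    (hM : ∀ k : Fin (m + 16), 16 ≤ k.val → M k j = 0) :
    ((treeGraph 0 m).adjMatrix ℝ * M) b j = 0 := by
  rw [Matrix.mul_apply]
  refine Finset.sum_eq_zero fun k _ => ?_
  rcases lt_or_ge k.val 16 with hk | hk
  · rw [SimpleGraph.adjMatrix_apply, if_neg (treeGraph_zero_not_adj_base hb hk), zero_mul]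
  · rw [hM k hk, mul_zero]

lemma adjMatrix_four_mul (M : Matrix (Fin (m + 16)) (Fin (m + 16)) ℝ) {b : Fin (m + 16)}
    (hb : b.val = 16) (i j : Fin (m + 16)) :
    ((treeGraph 4 m).adjMatrix ℝ * M) i j = ((treeGraph 0 m).adjMatrix ℝ * M) i j +
      (if i = baseVertex m 3 then M b j else 0) + (if i = b then M (baseVertex m 3) j else 0) := by
  rw [treeGraph_succ_adjMatrix (w := 3) (by norm_num) ℝ (a := baseVertex m 3) rfl hb]
  simp [add_mul, Matrix.vecMulVec_mul, Matrix.vecMulVec_apply, Pi.single_apply]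

lemma mul_adjMatrix_seven (M : Matrix (Fin (m + 16)) (Fin (m + 16)) ℝ) {b : Fin (m + 16)}
    (hb : b.val = 16) (i : Fin (m + 16)) {j : Fin 16} (hj : j ≠ 6) :
    (M * (treeGraph 7 m).adjMatrix ℝ) i (baseVertex m j) =
      ∑ k : Fin 16, if baseAdj j k then M i (baseVertex m k) else 0 := by
  have hjb : baseVertex m j ≠ b := baseVertex_ne hb.ge j
  have h := adjMatrix_zero_mul_baseVertex M.transpose j i
  simp only [Matrix.transpose_apply] at h
  rw [treeGraph_succ_adjMatrix (w := 6) (by norm_num) ℝ (a := baseVertex m 6) rfl hb,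
    mul_add, mul_add, Matrix.mul_vecMulVec, Matrix.mul_vecMulVec, Matrix.add_apply,
    Matrix.add_apply, Matrix.vecMulVec_apply, Matrix.vecMulVec_apply,
    Pi.single_eq_of_ne hjb, Pi.single_eq_of_ne ((baseVertex_injective m).ne hj), mul_zero,
    mul_zero, add_zero, add_zero, ← h, ← Matrix.transpose_apply (M * _),
    Matrix.transpose_mul, SimpleGraph.transpose_adjMatrix]

lemma apply_eq_zero_of_degree_ne {G₁ G₂ : SimpleGraph (Fin (m + 16))}
    (h : degMatrix G₁ * M = M * degMatrix G₂) {i j : Fin (m + 16)}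
    (hij : G₁.degree i ≠ G₂.degree j) : M i j = 0 := by
  have h' := congrFun (congrFun h i) j
  rw [degMatrix, degMatrix, Matrix.diagonal_mul, Matrix.mul_diagonal, mul_comm] at h'
  by_contra hM
  exact hij (by exact_mod_cast mul_left_cancel₀ hM h')

lemma treeGraph_succ_degree_baseVertex (hm : 1 ≤ m) (w i : Fin 16) :
    (treeGraph (w + 1) m).degree (baseVertex m i) = baseDegree i + if i = w then 1 else 0 := by
  have h := treeGraph_succ_degree w.isLt ℤ (a := baseVertex m w) (b := ⟨16, by omega⟩) rfl rfl
    (baseVertex m i)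
  simp only [treeGraph_zero_degree_base, (baseVertex_injective m).eq_iff,
    baseVertex_ne (show 16 ≤ (⟨16, by omega⟩ : Fin (m + 16)).val from le_rfl) i,
    if_false, add_zero] at h
  exact_mod_cast h

/-- A matrix intertwining both the adjacency and the degree matrices of the two trees
vanishes on the column of the vertex `7`. -/
lemma intertwiner_column_eq_zero (hm : 1 ≤ m)
    (hA : (treeGraph 4 m).adjMatrix ℝ * M = M * (treeGraph 7 m).adjMatrix ℝ)
    (hD : degMatrix (treeGraph 4 m) * M = M * degMatrix (treeGraph 7 m)) (i : Fin (m + 16)) :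
    M i (baseVertex m 6) = 0 := by
  obtain ⟨b, hb⟩ : ∃ b : Fin (m + 16), b.val = 16 := ⟨⟨16, by omega⟩, rfl⟩
  have d₂ := treeGraph_succ_degree_baseVertex hm 6
  have hbase (i j : Fin 16) (h : (baseDegree i + if i = 3 then 1 else 0) ≠
      baseDegree j + if j = 6 then 1 else 0) : M (baseVertex m i) (baseVertex m j) = 0 := by
    apply apply_eq_zero_of_degree_ne hD
    rwa [← treeGraph_succ_degree_baseVertex hm, ← d₂] at h
  have htail (j : Fin 16) (hj : (baseDegree j + if j = 6 then 1 else 0) = 3)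
      (i : Fin (m + 16)) (hi : 16 ≤ i.val) : M i (baseVertex m j) = 0 := by
    apply apply_eq_zero_of_degree_ne hD
    have h := treeGraph_degree_le_two (w := 4) (by norm_num) hi
    rw [← d₂] at hj
    exact (h.trans_lt (by rw [show (7 : ℕ) = ((6 : Fin 16) : ℕ) + 1 from rfl, hj]; norm_num)).ne
  have hattach (j : Fin 16) (h : (treeGraph 4 m).degree b ≠
      baseDegree j + if j = 6 then 1 else 0) : M b (baseVertex m j) = 0 := by
    apply apply_eq_zero_of_degree_ne hD
    rwa [← d₂] at h
  have hrow (i j : Fin 16) (hj : j ≠ 6) :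
      (∑ k : Fin 16, if baseAdj i k then M (baseVertex m k) (baseVertex m j) else 0) +
        (if i = 3 then M b (baseVertex m j) else 0) =
      ∑ k : Fin 16, if baseAdj j k then M (baseVertex m i) (baseVertex m k) else 0 := by
    have h := congrFun (congrFun hA (baseVertex m i)) (baseVertex m j)
    have hib : baseVertex m i ≠ b := baseVertex_ne hb.ge i
    rw [adjMatrix_four_mul M hb, mul_adjMatrix_seven M hb _ hj, adjMatrix_zero_mul_baseVertex,
      if_neg hib, add_zero] at h
    simpa only [(baseVertex_injective m).eq_iff] using h
  have hrowb : M (baseVertex m 3) (baseVertex m 8) =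
      M b (baseVertex m 7) + (M b (baseVertex m 9) + M b (baseVertex m 15)) := by
    have h := congrFun (congrFun hA b) (baseVertex m 8)
    have hba : b ≠ baseVertex m 3 := (baseVertex_ne hb.ge 3).symm
    rw [adjMatrix_four_mul M hb, mul_adjMatrix_seven M hb _ (by decide),
      adjMatrix_zero_mul_of_le hb.ge (htail 8 (by decide)), if_neg hba, if_pos rfl,
      congrFun (sum_baseAdj fun k => M b (baseVertex m k)) 8] at h
    simpa [add_assoc] using h
  replace hrow (i j : Fin 16) (hj : j ≠ 6) := by
    have h := hrow i j hj
    rw [congrFun (sum_baseAdj fun k => M (baseVertex m k) (baseVertex m j)) i,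
      congrFun (sum_baseAdj fun k => M (baseVertex m i) (baseVertex m k)) j] at h
    exact h
  have h38 : M (baseVertex m 3) (baseVertex m 8) = 0 ∧ M b (baseVertex m 7) = 0 := by
    have e39 := hrow 3 9 (by decide)
    have e315 := hrow 3 15 (by decide)
    simp [hbase 2 9 (by decide), hbase 4 9 (by decide), hbase 2 15 (by decide),
      hbase 4 15 (by decide)] at e39 e315
    by_cases hdeg : (treeGraph 4 m).degree b = 1
    · have h7 := hattach 7 (by rw [hdeg]; decide)
      constructor <;> linarith
    · have h9 := hattach 9 hdeg
      have h15 := hattach 15 hdeg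
      constructor <;> linarith
  rcases lt_or_ge i.val 16 with hi | hi
  · obtain ⟨i, rfl⟩ : ∃ i', baseVertex m i' = i := ⟨⟨i.val, hi⟩, rfl⟩
    by_cases hdeg : (baseDegree i + if i = 3 then 1 else 0) = 3
    · have hcases : ∀ i : Fin 16, (baseDegree i + if i = 3 then 1 else 0) = 3 →
          i = 2 ∨ i = 3 ∨ i = 5 ∨ i = 8 := by decide
      obtain rfl | rfl | rfl | rfl := hcases i hdeg
      · have e2_9 := hrow 2 9 (by decide)
        have e1_8 := hrow 1 8 (by decide)
        have e10_8 := hrow 10 8 (by decide)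
        have e2_7 := hrow 2 7 (by decide)
        simp [hbase 0 8 (by decide), hbase 1 9 (by decide), hbase 1 15 (by decide),
          hbase 3 7 (by decide), hbase 3 9 (by decide), hbase 10 9 (by decide),
          hbase 10 15 (by decide), hbase 11 8 (by decide)] at e2_9 e1_8 e10_8 e2_7
        linarith
      · have e5_9 := hrow 5 9 (by decide)
        have e4_8 := hrow 4 8 (by decide)
        have e3_7 := hrow 3 7 (by decide)
        simp [hbase 2 7 (by decide), hbase 4 9 (by decide), hbase 4 15 (by decide),
          hbase 6 9 (by decide), hbase 12 9 (by decide)] at e5_9 e4_8 e3_7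
        linarith
      · have e5_9 := hrow 5 9 (by decide)
        have e4_8 := hrow 4 8 (by decide)
        have e6_8 := hrow 6 8 (by decide)
        have e12_8 := hrow 12 8 (by decide)
        have e5_7 := hrow 5 7 (by decide)
        simp [hbase 4 9 (by decide), hbase 4 15 (by decide), hbase 6 9 (by decide),
          hbase 6 15 (by decide), hbase 7 8 (by decide), hbase 12 9 (by decide),
          hbase 12 15 (by decide), hbase 13 8 (by decide)] at e5_9 e4_8 e6_8 e12_8 e5_7
        linarith
      · have e8_7 := hrow 8 7 (by decide)
        have e7_8 := hrow 7 8 (by decide)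
        simp [hbase 6 8 (by decide), hbase 7 9 (by decide), hbase 7 15 (by decide),
          hbase 9 7 (by decide), hbase 15 7 (by decide)] at e8_7 e7_8
        linarith
    · exact hbase _ _ hdeg
  · exact htail 6 (by decide) i hi

end Intertwine

/-- For `m ≥ 1`, the trees `G₁` and `G₂` obtained from `𝖳` by attaching the path
`17–⋯–(16+m)` at vertex `4`, resp. vertex `7`, have `t I - L_μ(G₁)` and
`t I - L_μ(G₂)` equivalent over `ℚ(μ)[t]` (same Smith normal form), yet `G₁` and `G₂`
are not degree-similar. -/
theorem stmt6 (m : ℕ) (hm : 1 ≤ m) :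
    (∃ U W : Matrix (Fin (m + 16)) (Fin (m + 16)) (Polynomial (RatFunc ℚ)),
      IsUnit U.det ∧ IsUnit W.det ∧
      U * charLmu (treeGraph 4 m) * W = charLmu (treeGraph 7 m)) ∧
    ¬ DegreeSimilar (treeGraph 4 m) (treeGraph 7 m) := by
  constructor
  · obtain ⟨Q, hQ, h⟩ := treeGraph_four_seven_conj hm (RatFunc.X : RatFunc ℚ)
      isUnit_det_gram_baseKrylov
    obtain ⟨hdet, hconj⟩ := charLmu_conj hQ h
    exact ⟨_, _, hdet, hdet, hconj⟩
  · rintro ⟨M, hM, hA, hD⟩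
    have intertwine {A B : Matrix (Fin (m + 16)) (Fin (m + 16)) ℝ} (h : M⁻¹ * A * M = B) :
        A * M = M * B := by
      rw [← h, ← Matrix.mul_assoc, ← Matrix.mul_assoc, Matrix.mul_nonsing_inv _ hM,
        Matrix.one_mul]
    refine hM.ne_zero (Matrix.det_eq_zero_of_column_eq_zero (baseVertex m 6) ?_)
    exact intertwiner_column_eq_zero hm (intertwine hA) (intertwine hD)
end
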